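/- arXiv:0911.5377 — 3 statements merged into one kernel-verified Lean document; each statement's English description precedes it below -/
import Mathlib

section
/- For every 0 < p < p' < 1 there exists a discrete thickening from density p to density p' on {0,1}^ℤ. That is, there is a measurable function f : {0,1}^ℤ → {0,1}^ℤ such that the pushforward under f of the product measure Bernoulli(p)^ℤ is Bernoulli(p')^ℤ, and for Bernoulli(p)^ℤ-almost every x one has f(x)_i ≥ x_i for all i ∈ ℤ. -/
open MeasureTheory ProbabilityTheory

/-- The Bernoulli measure on `Bool` assigning mass `r` to `true`. -/
noncomputable def bernoulliMeasure (r : ℝ) : Measure Bool :=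
  ENNReal.ofReal r • Measure.dirac true + ENNReal.ofReal (1 - r) • Measure.dirac false

/-- `μ` is the product of Bernoulli(`r`) measures over the index set `I`:
it is a probability measure whose finite-dimensional marginals are i.i.d. Bernoulli(`r`). -/
def IsBernoulliProduct {I : Type*} (r : ℝ) (μ : Measure (I → Bool)) : Prop :=
  IsProbabilityMeasure μ ∧
    ∀ (s : Finset I) (b : I → Bool),
      μ {x | ∀ i ∈ s, x i = b i} =
        ∏ i ∈ s, (if b i then ENNReal.ofReal r else ENNReal.ofReal (1 - r))

namespace Thickening

open Measure Set Filter Topology unitInterval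

/-- A measure on a product of countable discrete spaces is the product measure as soon as it gives
the expected mass to all cylinders over points. -/
lemma eq_infinitePi_of_forall_cylinder {ι : Type*} {X : ι → Type*} [∀ i, MeasurableSpace (X i)]
    [∀ i, Countable (X i)] [∀ i, MeasurableSingletonClass (X i)] [∀ i, Nonempty (X i)]
    (μ : ∀ i, Measure (X i)) [∀ i, IsProbabilityMeasure (μ i)] {ν : Measure (∀ i, X i)}
    (h : ∀ (s : Finset ι) (b : ∀ i, X i), ν {x | ∀ i ∈ s, x i = b i} = ∏ i ∈ s, μ i {b i}) :
    ν = infinitePi μ := by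
  classical
  refine (isProjectiveLimit_infinitePi μ).unique (fun s ↦ ?_) |>.symm
  refine Measure.ext_of_singleton fun c ↦ ?_
  let b : ∀ i, X i := fun i ↦ if hi : i ∈ s then c ⟨i, hi⟩ else Classical.arbitrary _
  have hb : ∀ i : s, b i = c i := fun i ↦ by simp [b]
  rw [Measure.map_apply (by fun_prop) (measurableSet_singleton c), Measure.pi_singleton]
  have : s.restrict ⁻¹' {c} = {x : ∀ i, X i | ∀ i ∈ s, x i = b i} := by
    ext x
    simp only [mem_preimage, mem_singleton_iff, mem_ofPred_eq, funext_iff, Finset.restrict,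
      Subtype.forall]
    refine forall₂_congr fun i hi ↦ ?_
    rw [← hb ⟨i, hi⟩]
  rw [this, h, ← Finset.prod_coe_sort]
  exact Finset.prod_congr rfl fun i _ ↦ by rw [hb]

/-- Zipping two independent product measures gives the product of the pairwise products. -/
lemma infinitePi_prod_map_zip {ι X Y : Type*} [MeasurableSpace X] [MeasurableSpace Y]
    [Countable X] [Countable Y] [MeasurableSingletonClass X] [MeasurableSingletonClass Y]
    (μ : Measure X) (ν : Measure Y) [IsProbabilityMeasure μ] [IsProbabilityMeasure ν] :
    ((infinitePi fun _ : ι ↦ μ).prod (infinitePi fun _ : ι ↦ ν)).map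
        (fun q i ↦ (q.1 i, q.2 i)) = infinitePi fun _ : ι ↦ μ.prod ν := by
  have := nonempty_of_isProbabilityMeasure μ
  have := nonempty_of_isProbabilityMeasure ν
  refine eq_infinitePi_of_forall_cylinder _ fun s b ↦ ?_
  have hset : {x : ι → X × Y | ∀ i ∈ s, x i = b i} = (s : Set ι).pi fun i ↦ {b i} := by
    ext x; simp [Set.mem_pi]
  have hpre : (fun (q : (ι → X) × (ι → Y)) i ↦ (q.1 i, q.2 i)) ⁻¹'
      ((s : Set ι).pi fun i ↦ {b i}) =
      ((s : Set ι).pi fun i ↦ {(b i).1}) ×ˢ ((s : Set ι).pi fun i ↦ {(b i).2}) := by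
    ext q; simp [Set.mem_pi, Prod.ext_iff, forall_and]
  rw [hset, Measure.map_apply (by fun_prop)
    (MeasurableSet.pi s.countable_toSet fun i _ ↦ measurableSet_singleton _), hpre,
    Measure.prod_prod, infinitePi_pi _ (fun i _ ↦ measurableSet_singleton _),
    infinitePi_pi _ (fun i _ ↦ measurableSet_singleton _), ← Finset.prod_mul_distrib]
  refine Finset.prod_congr rfl fun i _ ↦ ?_
  rw [← Measure.prod_prod, singleton_prod_singleton]

/-- Combining two independent product measures coordinatewise gives a product measure. -/
lemma infinitePi_prod_map_zipWith {ι X Y Z : Type*} [MeasurableSpace X] [MeasurableSpace Y]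
    [MeasurableSpace Z] [Countable X] [Countable Y] [MeasurableSingletonClass X]
    [MeasurableSingletonClass Y] (μ : Measure X) (ν : Measure Y) [IsProbabilityMeasure μ]
    [IsProbabilityMeasure ν] {g : X → Y → Z} (hg : Measurable fun q : X × Y ↦ g q.1 q.2) :
    ((infinitePi fun _ : ι ↦ μ).prod (infinitePi fun _ : ι ↦ ν)).map
        (fun q i ↦ g (q.1 i) (q.2 i)) =
      infinitePi fun _ : ι ↦ (μ.prod ν).map fun q ↦ g q.1 q.2 := by
  rw [← infinitePi_map_pi (fun _ ↦ μ.prod ν) (fun _ ↦ hg), ← infinitePi_prod_map_zip,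
    Measure.map_map (by fun_prop) (by fun_prop)]
  rfl

/-- The probability integral transform: an atomless real law is mapped to the uniform law by its
distribution function. -/
lemma exists_measurable_map_eq_volume_unitInterval (ρ : Measure ℝ) [IsProbabilityMeasure ρ]
    [NullSingletonClass ρ] : ∃ f : ℝ → I, Measurable f ∧ ρ.map f = volume := by
  let F := cdf ρ
  have hcont : Continuous F := by
    refine continuous_iff_continuousAt.2 fun x ↦ ?_
    rw [F.mono.continuousAt_iff_leftLim_eq_rightLim, F.rightLim_eq]
    have h1 : F.measure {x} = 0 := by rw [measure_cdf]; exact measure_singleton x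
    rw [F.measure_singleton, ENNReal.ofReal_eq_zero] at h1
    exact le_antisymm (F.mono.leftLim_le le_rfl) (by linarith)
  have hsurj : ∀ t ∈ Ioo (0 : ℝ) 1, ∃ a, F a = t := fun t ht ↦
    mem_range_of_exists_le_of_exists_ge hcont
      (((tendsto_cdf_atBot ρ).eventually_lt_const ht.1).exists.imp fun _ h ↦ h.le)
      (((tendsto_cdf_atTop ρ).eventually_const_lt ht.2).exists.imp fun _ h ↦ h.le)
  let f : ℝ → I := fun x ↦ ⟨F x, cdf_nonneg ρ x, cdf_le_one ρ x⟩
  have hf : Measurable f := hcont.measurable.subtype_mk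
  refine ⟨f, hf, ?_⟩
  have : IsProbabilityMeasure (ρ.map f) := isProbabilityMeasure_map hf.aemeasurable
  have hlow : ∀ t : I, ENNReal.ofReal t ≤ ρ.map f (Iic t) := by
    intro t
    rcases eq_or_lt_of_le t.2.1 with h0 | h0
    · simp [← h0]
    rcases eq_or_lt_of_le t.2.2 with h1 | h1
    · have : Iic t = univ := by ext y; simpa using Subtype.coe_le_coe.1 (y.2.2.trans h1.ge)
      simp [this, h1]
    obtain ⟨a, ha⟩ := hsurj t ⟨h0, h1⟩
    rw [Measure.map_apply hf measurableSet_Iic, ← ha, ofReal_cdf]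
    exact measure_mono fun x hx ↦ show F x ≤ t from (F.mono hx).trans ha.le
  refine Measure.ext_of_Iic _ _ fun t ↦ ?_
  rw [unitInterval.volume_Iic]
  refine le_antisymm ?_ (hlow t)
  rcases eq_or_lt_of_le t.2.2 with h1 | h1
  · rw [h1, ENNReal.ofReal_one]; exact prob_le_one
  have hup : ∀ t' ∈ Ioo (t : ℝ) 1, ρ.map f (Iic t) ≤ ENNReal.ofReal t' := by
    intro t' ht'
    obtain ⟨a, ha⟩ := hsurj t' ⟨t.2.1.trans_lt ht'.1, ht'.2⟩
    rw [Measure.map_apply hf measurableSet_Iic, ← ha, ofReal_cdf]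
    refine measure_mono fun x hx ↦ ?_
    by_contra hxa
    have h2 : F a ≤ F x := F.mono (not_le.1 hxa).le
    have h3 : F x ≤ t := hx
    linarith [ht'.1]
  refine ge_of_tendsto (ENNReal.continuous_ofReal.tendsto (t : ℝ) |>.mono_left nhdsWithin_le_nhds)
    (Filter.eventually_of_mem (Ioo_mem_nhdsGT h1) hup)

instance : IsProbabilityMeasure (_root_.bernoulliMeasure (1 / 2)) := by
  constructor
  simp only [_root_.bernoulliMeasure, Measure.add_apply, Measure.smul_apply, measure_univ,
    smul_eq_mul, mul_one]
  rw [← ENNReal.ofReal_add] <;> norm_num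

lemma isProbabilityMeasure_bernoulliMeasure {r : ℝ} (h0 : 0 ≤ r) (h1 : r ≤ 1) :
    IsProbabilityMeasure (_root_.bernoulliMeasure r) := by
  constructor
  simp only [_root_.bernoulliMeasure, Measure.add_apply, Measure.smul_apply, measure_univ,
    smul_eq_mul, mul_one]
  rw [← ENNReal.ofReal_add h0 (by linarith)]
  simp

lemma bernoulliMeasure_singleton (r : ℝ) (b : Bool) :
    _root_.bernoulliMeasure r {b} = if b then ENNReal.ofReal r else ENNReal.ofReal (1 - r) := by
  cases b <;> simp [_root_.bernoulliMeasure]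

/-- The law of a sequence of independent fair bits. -/
noncomputable abbrev coin : Measure (ℕ → Bool) :=
  infinitePi fun _ ↦ _root_.bernoulliMeasure (1 / 2)

instance : NullSingletonClass coin := by
  refine ⟨fun x ↦ ?_⟩
  have h : ∀ n : ℕ, coin {x} ≤ (ENNReal.ofReal (1 / 2)) ^ n := by
    intro n
    calc coin {x} ≤ coin ((Finset.range n : Set ℕ).pi fun i ↦ {x i}) :=
          measure_mono (by rintro _ rfl; simp [Set.mem_pi])
      _ = (ENNReal.ofReal (1 / 2)) ^ n := by
          rw [infinitePi_pi _ (fun i _ ↦ measurableSet_singleton _)]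
          have : ∀ i, _root_.bernoulliMeasure (1 / 2) {x i} = ENNReal.ofReal (1 / 2) := fun i ↦ by
            rw [bernoulliMeasure_singleton]; norm_num
          simp only [this, Finset.prod_const, Finset.card_range]
  refine le_antisymm (ge_of_tendsto' (ENNReal.tendsto_pow_atTop_nhds_zero_of_lt_one ?_) h) zero_le
  rw [← ENNReal.ofReal_one, ENNReal.ofReal_lt_ofReal_iff one_pos]
  norm_num

/-- Every law on a standard Borel space can be simulated by fair coins. -/
lemma exists_measurable_map_coin_eq {Y : Type*} [MeasurableSpace Y] [StandardBorelSpace Y]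
    (lam : Measure Y) [IsProbabilityMeasure lam] :
    ∃ T : (ℕ → Bool) → Y, Measurable T ∧ coin.map T = lam := by
  have := nonempty_of_isProbabilityMeasure lam
  have hemb := measurableEmbedding_embeddingReal (ℕ → Bool)
  have : IsProbabilityMeasure (coin.map (embeddingReal (ℕ → Bool))) :=
    isProbabilityMeasure_map hemb.measurable.aemeasurable
  have : NullSingletonClass (coin.map (embeddingReal (ℕ → Bool))) := by
    refine ⟨fun x ↦ ?_⟩
    rw [hemb.map_apply]
    exact (subsingleton_singleton.preimage hemb.injective).measure_zero _
  obtain ⟨f, hf, hfmap⟩ :=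
    exists_measurable_map_eq_volume_unitInterval (coin.map (embeddingReal (ℕ → Bool)))
  obtain ⟨g, hg, hgmap⟩ := lam.exists_measurable_map_eq
  refine ⟨g ∘ f ∘ embeddingReal (ℕ → Bool), hg.comp (hf.comp hemb.measurable), ?_⟩
  rw [← Measure.map_map hg (hf.comp hemb.measurable), ← Measure.map_map hf hemb.measurable, hfmap,
    hgmap]

section Extraction

variable {W Y : Type*} [MeasurableSpace W] [Countable W] [MeasurableSingletonClass W]
  [MeasurableSpace Y] [Countable Y] [MeasurableSingletonClass Y]

open Classical in
/-- The sequence of bits carried by those terms of `x` that lie in `D`, in order of appearance. -/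
noncomputable def carriedBits (D : Set W) (bit : W → Bool) (x : ℕ → W) (n : ℕ) : Bool :=
  decide (∃ k, x k ∈ D ∧ Nat.count (fun j ↦ x j ∈ D) k = n ∧ bit (x k) = true)

lemma measurable_carriedBits (D : Set W) (bit : W → Bool) :
    Measurable (carriedBits D bit) := by
  classical
  have hD : ∀ k, MeasurableSet {x : ℕ → W | x k ∈ D} := fun k ↦
    measurable_pi_apply k (MeasurableSet.of_discrete (s := D))
  have hcount : ∀ k, Measurable fun x : ℕ → W ↦ Nat.count (fun j ↦ x j ∈ D) k := by
    intro k
    induction k with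
    | zero => simp
    | succ k ih =>
      simp only [Nat.count_succ]
      exact ih.add (Measurable.ite (hD k) measurable_const measurable_const)
  refine measurable_pi_lambda _ fun n ↦ measurable_to_bool ?_
  have : (fun x ↦ carriedBits D bit x n) ⁻¹' {true} = ⋃ k, ({x : ℕ → W | x k ∈ D} ∩
      ((fun x : ℕ → W ↦ Nat.count (fun j ↦ x j ∈ D) k) ⁻¹' {n} ∩
        (fun x ↦ x k) ⁻¹' (bit ⁻¹' {true}))) := by
    ext x
    simp [carriedBits]
  rw [this]
  exact MeasurableSet.iUnion fun k ↦ (hD k).inter ((hcount k (measurableSet_singleton n)).inter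
    (measurable_pi_apply k MeasurableSet.of_discrete))

omit [MeasurableSpace W] [Countable W] [MeasurableSingletonClass W] in
lemma carriedBits_eq {D : Set W} {bit : W → Bool} {x : ℕ → W}
    (h : {k | x k ∈ D}.Infinite) (n : ℕ) :
    carriedBits D bit x n = bit (x (Nat.nth (fun k ↦ x k ∈ D) n)) := by
  classical
  rw [Bool.eq_iff_iff, carriedBits, decide_eq_true_iff]
  constructor
  · rintro ⟨k, hk, rfl, hb⟩
    rwa [Nat.nth_count (p := fun k ↦ x k ∈ D) hk]
  · exact fun hb ↦ ⟨_, Nat.nth_mem_of_infinite h n, Nat.count_nth_of_infinite h n, hb⟩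

/-- Independent trials with positive success probability succeed infinitely often. -/
lemma ae_infinite_setOf_mem (ν : Measure W) [IsProbabilityMeasure ν] {D : Set W} (hD : ν D ≠ 0) :
    ∀ᵐ x ∂(infinitePi fun _ : ℕ ↦ ν), {k | x k ∈ D}.Infinite := by
  have hDm : MeasurableSet D := MeasurableSet.of_discrete
  have key : ∀ N : ℕ, ∀ᵐ x ∂(infinitePi fun _ : ℕ ↦ ν), ∃ k, N ≤ k ∧ x k ∈ D := by
    intro N
    rw [ae_iff]
    have h : ∀ n : ℕ, (infinitePi fun _ : ℕ ↦ ν) {x | ¬ ∃ k, N ≤ k ∧ x k ∈ D} ≤ (ν Dᶜ) ^ n := by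
      intro n
      calc _ ≤ (infinitePi fun _ : ℕ ↦ ν) ((Finset.Ico N (N + n) : Set ℕ).pi fun _ ↦ Dᶜ) :=
            measure_mono fun x (hx : ¬ _) i hi hxi ↦ hx ⟨i, (Finset.mem_Ico.1 hi).1, hxi⟩
        _ = (ν Dᶜ) ^ n := by
            rw [infinitePi_pi _ (fun i _ ↦ hDm.compl)]
            simp
    refine le_antisymm (ge_of_tendsto' (ENNReal.tendsto_pow_atTop_nhds_zero_of_lt_one ?_) h)
      zero_le
    rw [prob_compl_eq_one_sub hDm]
    exact ENNReal.sub_lt_self ENNReal.one_ne_top one_ne_zero hD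
  filter_upwards [ae_all_iff.2 key] with x hx
  exact Nat.frequently_atTop_iff_infinite.1 (Filter.frequently_atTop.2 hx)

/-- Suppose that resampling the bit carried by a term in `D` does not change the law `ν`, and
that `F` ignores these bits. Then the carried bits can be used as the external randomness `Y`,
so that a randomised map `F` from `ν` to `ν'` yields a deterministic map between sequences. -/
theorem exists_measurable_map_infinitePi (ν ν' : Measure W) [IsProbabilityMeasure ν]
    [IsProbabilityMeasure ν'] (lam : Measure Y) [IsProbabilityMeasure lam] {D : Set W}
    (hD : ν D ≠ 0) (bit : W → Bool) (φ : W → Bool → W) (hφD : ∀ w b, φ w b ∈ D ↔ w ∈ D)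
    (hφbit : ∀ w ∈ D, ∀ b, bit (φ w b) = b)
    (hφ : (ν.prod (_root_.bernoulliMeasure (1 / 2))).map (fun q ↦ φ q.1 q.2) = ν)
    (F : W → Y → W) (hFφ : ∀ w b y, F (φ w b) y = F w y)
    (hF : (ν.prod lam).map (fun q ↦ F q.1 q.2) = ν') :
    ∃ f : (ℕ → W) → (ℕ → W), Measurable f ∧
      (infinitePi fun _ ↦ ν).map f = infinitePi (fun _ ↦ ν') ∧ ∀ x k, ∃ y, f x k = F (x k) y := by
  obtain ⟨T, hT, hTmap⟩ := exists_measurable_map_coin_eq (infinitePi fun _ : ℕ ↦ lam)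
  have hbits := measurable_carriedBits D bit
  let Φ : (ℕ → W) × (ℕ → Bool) → ℕ → W := fun q k ↦ φ (q.1 k) (q.2 k)
  have hφm : Measurable fun q : W × Bool ↦ φ q.1 q.2 := measurable_of_countable _
  have hFm : Measurable fun q : W × Y ↦ F q.1 q.2 := measurable_of_countable _
  have hΦ : Measurable Φ := by
    refine measurable_pi_lambda _ fun k ↦ ?_
    exact hφm.comp (f := fun q : (ℕ → W) × (ℕ → Bool) ↦ (q.1 k, q.2 k)) (by fun_prop)
  have hΦmap : ((infinitePi fun _ ↦ ν).prod coin).map Φ = infinitePi fun _ ↦ ν := by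
    refine (infinitePi_prod_map_zipWith ν (_root_.bernoulliMeasure (1 / 2)) hφm).trans ?_
    simp_rw [hφ]
  let f : (ℕ → W) → (ℕ → W) := fun x k ↦ F (x k) (T (carriedBits D bit x) k)
  have hTb : Measurable fun x ↦ T (carriedBits D bit x) := hT.comp hbits
  have hf : Measurable f := by
    refine measurable_pi_lambda _ fun k ↦ ?_
    exact hFm.comp (f := fun x : ℕ → W ↦ (x k, T (carriedBits D bit x) k)) (by fun_prop)
  have hskew : MeasurePreserving
      (fun q : (ℕ → W) × (ℕ → Bool) ↦ (q.1, T (carriedBits D bit (Φ q))))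
      ((infinitePi fun _ ↦ ν).prod coin)
      ((infinitePi fun _ ↦ ν).prod (infinitePi fun _ ↦ lam)) := by
    refine (MeasurePreserving.id _).skew_product
      (g := fun s b ↦ T (carriedBits D bit (Φ (s, b)))) (hTb.comp hΦ) ?_
    filter_upwards [ae_infinite_setOf_mem ν hD] with s hs
    have hset : ∀ b, (fun k ↦ Φ (s, b) k ∈ D) = fun k ↦ s k ∈ D := fun b ↦
      funext fun k ↦ propext (hφD _ _)
    have h1 : (fun b ↦ carriedBits D bit (Φ (s, b))) =
        fun b n ↦ b (Nat.nth (fun k ↦ s k ∈ D) n) := by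
      funext b n
      rw [carriedBits_eq (by rwa [hset]), hset]
      exact hφbit _ (Nat.nth_mem_of_infinite hs n) _
    have h2 : (fun b ↦ T (carriedBits D bit (Φ (s, b)))) =
        T ∘ fun b n ↦ b (Nat.nth (fun k ↦ s k ∈ D) n) := by
      rw [← h1]; rfl
    rw [h2, ← Measure.map_map hT (by fun_prop),
      map_infinitePi_infinitePi_of_inj (Nat.nth_injective hs), hTmap]
  refine ⟨f, hf, ?_, fun x k ↦ ⟨_, rfl⟩⟩
  have hcomp : f ∘ Φ = (fun q k ↦ F (q.1 k) (q.2 k)) ∘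
      fun q : (ℕ → W) × (ℕ → Bool) ↦ (q.1, T (carriedBits D bit (Φ q))) := by
    funext q k
    exact hFφ _ _ _
  have hFzip : Measurable fun (q : (ℕ → W) × (ℕ → Y)) k ↦ F (q.1 k) (q.2 k) := by
    refine measurable_pi_lambda _ fun k ↦ ?_
    exact hFm.comp (f := fun q : (ℕ → W) × (ℕ → Y) ↦ (q.1 k, q.2 k)) (by fun_prop)
  conv_lhs => rw [← hΦmap]
  rw [Measure.map_map hf hΦ, hcomp, ← Measure.map_map hFzip hskew.measurable, hskew.map_eq,
    infinitePi_prod_map_zipWith ν lam hFm, hF]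

end Extraction

section Block

lemma prod_ite_two {ι : Type*} [Fintype ι] [DecidableEq ι] {i j : ι} (hij : i ≠ j) (A B C : ℝ) :
    ∏ k, (if k = i then A else if k = j then B else C) = A * B * C ^ (Fintype.card ι - 2) := by
  rw [← Finset.mul_prod_erase _ _ (Finset.mem_univ i), ← Finset.mul_prod_erase _ _
    (Finset.mem_erase.2 ⟨hij.symm, Finset.mem_univ j⟩), if_pos rfl, if_neg hij.symm, if_pos rfl,
    Finset.prod_congr rfl (g := fun _ ↦ C), Finset.prod_const,
    Finset.card_erase_of_mem (Finset.mem_erase.2 ⟨hij.symm, Finset.mem_univ j⟩),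
    Finset.card_erase_of_mem (Finset.mem_univ i), Finset.card_univ, mul_assoc, Nat.sub_sub]
  intro k hk
  simp only [Finset.mem_erase] at hk
  rw [if_neg hk.2.1, if_neg hk.1]

/-- The configuration with a single zero, at `i`. -/
def holeAt {ι : Type*} [DecidableEq ι] (i : ι) : ι → Bool := fun k ↦ decide (k ≠ i)

variable {ι : Type*} [DecidableEq ι]

lemma holeAt_injective : Function.Injective (holeAt (ι := ι)) := fun i j h ↦ by
  have := congrFun h i
  simpa [holeAt] using this

variable [Fintype ι]

/-- Fill up `w` completely if it is one of the two configurations `holeAt i`, `holeAt j`; otherwise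
take the maximum of `w` and the noise, except that a full configuration obtained this way is
sometimes replaced by `holeAt i` or `holeAt j`. -/
def fill (i j : ι) (w : ι → Bool) (y : (ι → Bool) × Bool) : ι → Bool :=
  if w = holeAt i ∨ w = holeAt j then ⊤
  else if w ⊔ y.1 = ⊤ ∧ w i = false ∧ w j = true ∧ y.2 = true then holeAt i
  else if w ⊔ y.1 = ⊤ ∧ w j = false ∧ w i = true ∧ y.2 = true then holeAt j
  else w ⊔ y.1

lemma fill_comm (i j : ι) : fill i j = fill j i := by
  funext w y
  unfold fill
  grind

lemma le_fill (i j : ι) (w : ι → Bool) (y : (ι → Bool) × Bool) : w ≤ fill i j w y := by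
  have h : ∀ k, w k = false → w ≤ holeAt k := by
    intro k hk l
    by_cases hl : l = k
    · rw [hl, hk]; exact Bool.false_le _
    · simp [holeAt, hl, Bool.le_true]
  unfold fill
  split_ifs with h1 h2 h3
  · exact le_top
  · exact h i h2.2.1
  · exact h j h3.2.1
  · exact le_sup_left

omit [Fintype ι] in
lemma holeAt_self (i : ι) : holeAt i i = false := by simp [holeAt]

omit [Fintype ι] in
lemma holeAt_of_ne {i k : ι} (h : k ≠ i) : holeAt i k = true := by simp [holeAt, h]

omit [Fintype ι] in
lemma holeAt_ne_top (i : ι) : holeAt i ≠ ⊤ := fun h ↦ by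
  simpa [holeAt_self] using congrFun h i

omit [Fintype ι] in
lemma holeAt_sup (i : ι) (z : ι → Bool) : holeAt i ⊔ z = holeAt i ∨ holeAt i ⊔ z = ⊤ := by
  by_cases hz : z i
  · refine Or.inr (funext fun k ↦ ?_)
    by_cases hk : k = i <;> simp [holeAt, hk, hz]
  · refine Or.inl (funext fun k ↦ ?_)
    by_cases hk : k = i <;> simp [holeAt, hk, hz]

lemma fill_eq_holeAt_iff {i j : ι} (hij : i ≠ j) (w : ι → Bool) (y : (ι → Bool) × Bool) :
    fill i j w y = holeAt i ↔ w ≠ holeAt i ∧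
      (w ⊔ y.1 = holeAt i ∨ w ⊔ y.1 = ⊤ ∧ w i = false ∧ w j = true ∧ y.2 = true) := by
  by_cases hi : w = holeAt i
  · simp [fill, hi, (holeAt_ne_top i).symm]
  by_cases hj : w = holeAt j
  · have h : holeAt j ⊔ y.1 ≠ holeAt i := fun h ↦ by
      simpa [holeAt_self, holeAt_of_ne hij] using congrFun h i
    simp [fill, hj, (holeAt_ne_top i).symm, h, holeAt_of_ne hij]
  have hne : holeAt j ≠ holeAt i := holeAt_injective.ne hij.symm
  unfold fill
  rw [if_neg (by tauto)]
  split_ifs with h1 h2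
  · simp only [true_iff]
    exact ⟨hi, Or.inr h1⟩
  · simp [hne, h2, (holeAt_ne_top i).symm]
  · tauto

lemma fill_eq_iff {i j : ι} {c : ι → Bool} (hc : c ≠ ⊤) (hi : c ≠ holeAt i) (hj : c ≠ holeAt j)
    (w : ι → Bool) (y : (ι → Bool) × Bool) : fill i j w y = c ↔ w ⊔ y.1 = c := by
  unfold fill
  split_ifs with h h1 h2
  · have : w ⊔ y.1 ≠ c := by
      rcases h with rfl | rfl
      · rcases holeAt_sup i y.1 with h | h <;> rw [h] <;> tauto
      · rcases holeAt_sup j y.1 with h | h <;> rw [h] <;> tauto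
    tauto
  · rw [h1.1]; tauto
  · rw [h2.1]; tauto
  · rfl

omit [Fintype ι] in
lemma sup_eq_top_and_iff {i j : ι} (hij : i ≠ j) (w z : ι → Bool) :
    (w ⊔ z = ⊤ ∧ w i = false ∧ w j = true) ↔
      ∀ k, (w k, z k) ∈ if k = i then {false} ×ˢ {true} else if k = j then {true} ×ˢ univ
        else {t : Bool × Bool | (t.1 || t.2) = true} := by
  have hsup : ∀ k, (w ⊔ z) k = (w k || z k) := fun _ ↦ rfl
  constructor
  · rintro ⟨h, hi, hj⟩ k
    have hk : (w k || z k) = true := by rw [← hsup, h]; rfl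
    split_ifs with h1 h2
    · subst h1
      simpa [hi] using hk
    · subst h2
      simp [hj]
    · exact hk
  · intro h
    have hi : w i = false ∧ z i = true := by simpa using h i
    have hj : w j = true := by simpa [hij.symm] using h j
    refine ⟨funext fun k ↦ ?_, hi.1, hj⟩
    rw [hsup, Pi.top_apply]
    have hk := h k
    split_ifs at hk with h1 h2
    · rw [h1, hi.1, hi.2]; rfl
    · rw [h2, hj]; rfl
    · exact hk

/-- Swap `holeAt i` and `holeAt j` according to a bit. -/
def resample (i j : ι) (w : ι → Bool) (b : Bool) : ι → Bool :=
  if w = holeAt i ∨ w = holeAt j then (if b then holeAt j else holeAt i) else w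

lemma resample_mem_iff (i j : ι) (w : ι → Bool) (b : Bool) :
    (resample i j w b = holeAt i ∨ resample i j w b = holeAt j) ↔
      (w = holeAt i ∨ w = holeAt j) := by
  simp only [resample]
  grind

lemma fill_resample (i j : ι) (w : ι → Bool) (b : Bool) (y : (ι → Bool) × Bool) :
    fill i j (resample i j w b) y = fill i j w y := by
  by_cases h : w = holeAt i ∨ w = holeAt j
  · have h' := (resample_mem_iff i j w b).2 h
    rw [fill, if_pos h', fill, if_pos h]
  · rw [resample, if_neg h]

lemma prod_map_resample {i j : ι} (hij : i ≠ j) (ν : Measure (ι → Bool)) [IsProbabilityMeasure ν]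
    (hν : ν {holeAt i} = ν {holeAt j}) :
    (ν.prod (_root_.bernoulliMeasure (1 / 2))).map (fun q ↦ resample i j q.1 q.2) = ν := by
  have hne : holeAt i ≠ holeAt j := holeAt_injective.ne hij
  have hhalf : ∀ b, _root_.bernoulliMeasure (1 / 2) {b} = 2⁻¹ := fun b ↦ by
    have : ENNReal.ofReal (1 / 2) = 2⁻¹ := by
      rw [one_div, ENNReal.ofReal_inv_of_pos two_pos, ENNReal.ofReal_ofNat]
    rw [bernoulliMeasure_singleton, show (1 - 1 / 2 : ℝ) = 1 / 2 by norm_num, ite_self, this]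
  have hpair : ν {holeAt i, holeAt j} * 2⁻¹ = ν {holeAt i} := by
    rw [insert_eq, measure_union (by simpa using hne) (measurableSet_singleton _), ← hν, ← mul_two,
      mul_assoc, ENNReal.mul_inv_cancel two_ne_zero ENNReal.ofNat_ne_top, mul_one]
  refine Measure.ext_of_singleton fun w ↦ ?_
  rw [Measure.map_apply (measurable_of_countable _) (measurableSet_singleton _)]
  by_cases hi : w = holeAt i
  · have : (fun q : (ι → Bool) × Bool ↦ resample i j q.1 q.2) ⁻¹' {w} =
        {holeAt i, holeAt j} ×ˢ {false} := by
      ext ⟨u, b⟩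
      simp only [mem_preimage, mem_singleton_iff, mem_prod, mem_insert_iff, resample]
      grind
    rw [this, Measure.prod_prod, hhalf, hpair, hi]
  by_cases hj : w = holeAt j
  · have : (fun q : (ι → Bool) × Bool ↦ resample i j q.1 q.2) ⁻¹' {w} =
        {holeAt i, holeAt j} ×ˢ {true} := by
      ext ⟨u, b⟩
      simp only [mem_preimage, mem_singleton_iff, mem_prod, mem_insert_iff, resample]
      grind
    rw [this, Measure.prod_prod, hhalf, hpair, hj, hν]
  · have : (fun q : (ι → Bool) × Bool ↦ resample i j q.1 q.2) ⁻¹' {w} = {w} ×ˢ univ := by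
      ext ⟨u, b⟩
      simp only [mem_preimage, mem_singleton_iff, mem_prod, mem_univ, resample]
      grind
    rw [this, Measure.prod_prod, measure_univ, mul_one]

omit [DecidableEq ι] in
lemma measureReal_prod_box (μ ν β : Measure Bool) [IsProbabilityMeasure μ]
    [IsProbabilityMeasure ν] [IsProbabilityMeasure β] (C : ι → Set (Bool × Bool)) (V : Set Bool) :
    ((infinitePi fun _ : ι ↦ μ).prod ((infinitePi fun _ : ι ↦ ν).prod β)).real
        {x | (∀ k, (x.1 k, x.2.1 k) ∈ C k) ∧ x.2.2 ∈ V} =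
      (∏ k, (μ.prod ν).real (C k)) * β.real V := by
  have hset : {x : (ι → Bool) × (ι → Bool) × Bool | (∀ k, (x.1 k, x.2.1 k) ∈ C k) ∧ x.2.2 ∈ V} =
      MeasurableEquiv.prodAssoc.symm ⁻¹'
        (((fun (q : (ι → Bool) × (ι → Bool)) k ↦ (q.1 k, q.2 k)) ⁻¹' univ.pi C) ×ˢ V) := by
    ext ⟨w, z, v⟩
    simp [MeasurableEquiv.prodAssoc, Set.mem_pi]
  have hC : MeasurableSet (univ.pi C) := MeasurableSet.univ_pi fun _ ↦ MeasurableSet.of_discrete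
  have hbox : infinitePi (fun _ : ι ↦ μ.prod ν) (univ.pi C) = ∏ k, (μ.prod ν) (C k) := by
    rw [infinitePi_eq_pi, Measure.pi_pi]
  rw [hset, measureReal_def, ← MeasurableEquiv.map_apply,
    ((measurePreserving_prodAssoc _ _ _).symm _).map_eq, Measure.prod_prod,
    ← Measure.map_apply (by fun_prop) hC, infinitePi_prod_map_zip, hbox, ENNReal.toReal_mul,
    ENNReal.toReal_prod]
  rfl

lemma bernoulliMeasure_real_singleton {r : ℝ} (h0 : 0 ≤ r) (h1 : r ≤ 1) (b : Bool) :
    (_root_.bernoulliMeasure r).real {b} = if b then r else 1 - r := by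
  rw [measureReal_def, bernoulliMeasure_singleton]
  split_ifs
  · exact ENNReal.toReal_ofReal h0
  · exact ENNReal.toReal_ofReal (by linarith)

/-- The law of `fill` is the product law of the higher density, when the noise has the right
parameters. -/
lemma prod_map_fill {p p' q θ : ℝ} {i j : ι} (hij : i ≠ j) (hp : p ∈ Icc 0 1) (hp' : p' ∈ Icc 0 1)
    (hq : q ∈ Icc 0 1) (hθ : θ ∈ Icc 0 1) (hpq : (1 - p) * (1 - q) = 1 - p')
    (hbal : p ^ (Fintype.card ι - 2) * (1 - p') + θ * ((p' - p) * p ^ (Fintype.card ι - 2)) =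
      θ * ((p' - p) * p' ^ (Fintype.card ι - 2))) :
    ((infinitePi fun _ : ι ↦ _root_.bernoulliMeasure p).prod
        ((infinitePi fun _ : ι ↦ _root_.bernoulliMeasure q).prod (_root_.bernoulliMeasure θ))).map
      (fun x ↦ fill i j x.1 x.2) = infinitePi fun _ ↦ _root_.bernoulliMeasure p' := by
  have := isProbabilityMeasure_bernoulliMeasure hp.1 hp.2
  have := isProbabilityMeasure_bernoulliMeasure hp'.1 hp'.2
  have := isProbabilityMeasure_bernoulliMeasure hq.1 hq.2
  have := isProbabilityMeasure_bernoulliMeasure hθ.1 hθ.2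
  set β := _root_.bernoulliMeasure θ with hβ
  set ρ := (infinitePi fun _ : ι ↦ _root_.bernoulliMeasure p).prod
    ((infinitePi fun _ : ι ↦ _root_.bernoulliMeasure q).prod β) with hρ
  set τ := (_root_.bernoulliMeasure p).prod (_root_.bernoulliMeasure q) with hτ
  have hτ00 : τ.real ({false} ×ˢ {false}) = 1 - p' := by
    rw [hτ, measureReal_prod_prod, bernoulliMeasure_real_singleton hp.1 hp.2,
      bernoulliMeasure_real_singleton hq.1 hq.2]
    simpa using hpq
  have hτ01 : τ.real ({false} ×ˢ {true}) = p' - p := by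
    rw [hτ, measureReal_prod_prod, bernoulliMeasure_real_singleton hp.1 hp.2,
      bernoulliMeasure_real_singleton hq.1 hq.2]
    simp only [Bool.false_eq_true, if_false, if_true]
    linarith
  have hτ1 : τ.real ({true} ×ˢ univ) = p := by
    rw [hτ, measureReal_prod_prod, bernoulliMeasure_real_singleton hp.1 hp.2, probReal_univ,
      if_pos rfl, mul_one]
  have hτsup : ∀ c, τ.real {t | (t.1 || t.2) = c} = (_root_.bernoulliMeasure p').real {c} := by
    intro c
    rw [bernoulliMeasure_real_singleton hp'.1 hp'.2]
    cases c
    · rw [← hτ00]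
      simp only [Bool.false_eq_true, if_false]
      rw [hτ00, ← hτ00]
      congr 1
      ext ⟨a, b⟩
      simp
    · have : {t : Bool × Bool | (t.1 || t.2) = true} = ({false} ×ˢ {false})ᶜ := by
        ext ⟨a, b⟩
        cases a <;> cases b <;> simp
      rw [this, probReal_compl_eq_one_sub MeasurableSet.of_discrete, hτ00]
      simp
  have hβtrue : β.real {true} = θ := by
    rw [hβ, bernoulliMeasure_real_singleton hθ.1 hθ.2, if_pos rfl]
  have hp'true : (_root_.bernoulliMeasure p').real {true} = p' := by
    rw [bernoulliMeasure_real_singleton hp'.1 hp'.2, if_pos rfl]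
  have hνreal : ∀ c : ι → Bool, (infinitePi fun _ : ι ↦ _root_.bernoulliMeasure p').real {c} =
      ∏ k, (_root_.bernoulliMeasure p').real {c k} := fun c ↦ by
    rw [measureReal_def, infinitePi_singleton_of_fintype, ENNReal.toReal_prod]
    rfl
  have hsup : ∀ c : ι → Bool, ρ.real {x | x.1 ⊔ x.2.1 = c} =
      (infinitePi fun _ : ι ↦ _root_.bernoulliMeasure p').real {c} := by
    intro c
    have := measureReal_prod_box (_root_.bernoulliMeasure p) (_root_.bernoulliMeasure q) β
      (fun k ↦ {t | (t.1 || t.2) = c k}) univ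
    simp only [← hτ, hτsup, probReal_univ, mul_one] at this
    rw [hνreal, ← this]
    congr 1
    ext x
    simp [funext_iff]
  have hfill : Measurable fun x : (ι → Bool) × (ι → Bool) × Bool ↦ fill i j x.1 x.2 :=
    measurable_of_countable _
  have : IsProbabilityMeasure (ρ.map fun x ↦ fill i j x.1 x.2) :=
    isProbabilityMeasure_map hfill.aemeasurable
  have hole : ∀ i j : ι, i ≠ j → ρ.real {x | fill i j x.1 x.2 = holeAt i} =
      ρ.real {x | x.1 ⊔ x.2.1 = holeAt i} := by
    intro i j hij
    have hji := hij.symm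
    have hE1 : ρ.real {x | x.1 = holeAt i ∧ x.1 ⊔ x.2.1 = holeAt i} =
        (1 - p') * p * p ^ (Fintype.card ι - 2) := by
      have h := measureReal_prod_box (_root_.bernoulliMeasure p) (_root_.bernoulliMeasure q) β
        (fun k ↦ if k = i then {false} ×ˢ {false} else if k = j then {true} ×ˢ univ
          else {true} ×ˢ univ) univ
      simp only [← hτ, apply_ite τ.real, hτ00, hτ1, prod_ite_two hij, probReal_univ, mul_one] at h
      rw [← h]
      congr 1
      ext ⟨w, z, v⟩
      simp only [mem_ofPred_eq, mem_univ, and_true, funext_iff, ← forall_and]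
      refine forall_congr' fun k ↦ ?_
      by_cases hk : k = i
      · simp [holeAt, hk]
      · simp +contextual [holeAt, hk]
    have hE2 : ρ.real {x | x.1 = holeAt i ∧ x.1 ⊔ x.2.1 = ⊤ ∧ x.2.2 = true} =
        (p' - p) * p * p ^ (Fintype.card ι - 2) * θ := by
      have h := measureReal_prod_box (_root_.bernoulliMeasure p) (_root_.bernoulliMeasure q) β
        (fun k ↦ if k = i then {false} ×ˢ {true} else if k = j then {true} ×ˢ univ
          else {true} ×ˢ univ) {true}
      simp only [← hτ, apply_ite τ.real, hτ01, hτ1, prod_ite_two hij, hβtrue] at h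
      rw [← h]
      congr 1
      ext ⟨w, z, v⟩
      simp only [mem_ofPred_eq, mem_singleton_iff, funext_iff, ← and_assoc, ← forall_and]
      refine and_congr_left fun _ ↦ forall_congr' fun k ↦ ?_
      by_cases hk : k = i
      · simp +contextual [holeAt, hk]
      · simp +contextual [holeAt, hk]
    have hG2 : ρ.real {x | x.1 ⊔ x.2.1 = ⊤ ∧ x.1 i = false ∧ x.1 j = true ∧ x.2.2 = true} =
        (p' - p) * p * p' ^ (Fintype.card ι - 2) * θ := by
      have h := measureReal_prod_box (_root_.bernoulliMeasure p) (_root_.bernoulliMeasure q) β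
        (fun k ↦ if k = i then {false} ×ˢ {true} else if k = j then {true} ×ˢ univ
          else {t | (t.1 || t.2) = true}) {true}
      simp only [← hτ, apply_ite τ.real, hτ01, hτ1, hτsup, hp'true, prod_ite_two hij, hβtrue] at h
      rw [← h]
      congr 1
      ext ⟨w, z, v⟩
      simp only [mem_ofPred_eq, mem_singleton_iff, ← and_assoc]
      refine and_congr_left fun _ ↦ ?_
      rw [and_assoc, sup_eq_top_and_iff hij]
    have hset : {x : (ι → Bool) × (ι → Bool) × Bool | fill i j x.1 x.2 = holeAt i} ∪
        ({x | x.1 = holeAt i ∧ x.1 ⊔ x.2.1 = holeAt i} ∪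
          {x | x.1 = holeAt i ∧ x.1 ⊔ x.2.1 = ⊤ ∧ x.2.2 = true}) =
        {x | x.1 ⊔ x.2.1 = holeAt i} ∪
          {x | x.1 ⊔ x.2.1 = ⊤ ∧ x.1 i = false ∧ x.1 j = true ∧ x.2.2 = true} := by
      ext ⟨w, z, v⟩
      simp only [mem_union, mem_ofPred_eq, fill_eq_holeAt_iff hij]
      by_cases hw : w = holeAt i
      · subst hw
        simp [holeAt_self, holeAt_of_ne hji]
      · tauto
    have hd1 : Disjoint {x : (ι → Bool) × (ι → Bool) × Bool | fill i j x.1 x.2 = holeAt i}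
        ({x | x.1 = holeAt i ∧ x.1 ⊔ x.2.1 = holeAt i} ∪
          {x | x.1 = holeAt i ∧ x.1 ⊔ x.2.1 = ⊤ ∧ x.2.2 = true}) := by
      rw [Set.disjoint_left]
      rintro ⟨w, z, v⟩
      simp only [mem_union, mem_ofPred_eq, fill_eq_holeAt_iff hij]
      tauto
    have hd2 : Disjoint
        {x : (ι → Bool) × (ι → Bool) × Bool | x.1 = holeAt i ∧ x.1 ⊔ x.2.1 = holeAt i}
        {x | x.1 = holeAt i ∧ x.1 ⊔ x.2.1 = ⊤ ∧ x.2.2 = true} := by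
      rw [Set.disjoint_left]
      rintro x ⟨-, h⟩ ⟨-, h', -⟩
      exact holeAt_ne_top i (h.symm.trans h')
    have hd3 : Disjoint {x : (ι → Bool) × (ι → Bool) × Bool | x.1 ⊔ x.2.1 = holeAt i}
        {x | x.1 ⊔ x.2.1 = ⊤ ∧ x.1 i = false ∧ x.1 j = true ∧ x.2.2 = true} := by
      rw [Set.disjoint_left]
      rintro x h ⟨h', -⟩
      exact holeAt_ne_top i (h.symm.trans h')
    have hsum := congrArg ρ.real hset
    rw [measureReal_union hd1 MeasurableSet.of_discrete,
      measureReal_union hd2 MeasurableSet.of_discrete,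
      measureReal_union hd3 MeasurableSet.of_discrete, hE1, hE2, hG2] at hsum
    linear_combination hsum - p * hbal
  have hpt : ∀ c : ι → Bool, c ≠ ⊤ → (ρ.map fun x ↦ fill i j x.1 x.2).real {c} =
      (infinitePi fun _ : ι ↦ _root_.bernoulliMeasure p').real {c} := by
    intro c hc
    rw [map_measureReal_apply hfill (measurableSet_singleton c), ← hsup]
    by_cases hci : c = holeAt i
    · rw [hci]; exact hole i j hij
    by_cases hcj : c = holeAt j
    · rw [hcj, fill_comm]; exact hole j i hij.symm
    congr 1
    ext ⟨w, z, v⟩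
    exact fill_eq_iff hc hci hcj w (z, v)
  refine Measure.ext_of_singleton fun c ↦ (measureReal_eq_measureReal_iff).1 ?_
  by_cases hc : c = ⊤
  · rw [hc]
    have h1 : ∀ μ : Measure (ι → Bool), IsProbabilityMeasure μ →
        μ.real {⊤} = 1 - ∑ c ∈ Finset.univ.erase ⊤, μ.real {c} := by
      intro μ _
      rw [eq_sub_iff_add_eq, Finset.add_sum_erase _ (fun c ↦ μ.real {c}) (Finset.mem_univ _),
        sum_measureReal_singleton]
      simp
    rw [h1 _ inferInstance, h1 _ inferInstance]
    exact congrArg _ (Finset.sum_congr rfl fun c hc ↦ hpt c (Finset.ne_of_mem_erase hc))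
  · exact hpt c hc

end Block

lemma isBernoulliProduct_infinitePi {J : Type*} {r : ℝ} (h0 : 0 ≤ r) (h1 : r ≤ 1) :
    IsBernoulliProduct r (infinitePi fun _ : J ↦ _root_.bernoulliMeasure r) := by
  have := isProbabilityMeasure_bernoulliMeasure h0 h1
  refine ⟨inferInstance, fun s b ↦ ?_⟩
  have hset : {x : J → Bool | ∀ i ∈ s, x i = b i} = (s : Set J).pi fun i ↦ {b i} := by
    ext x; simp [Set.mem_pi]
  rw [hset, infinitePi_pi _ fun i _ ↦ measurableSet_singleton _]
  exact Finset.prod_congr rfl fun i _ ↦ bernoulliMeasure_singleton r (b i)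

lemma eq_infinitePi_of_isBernoulliProduct {J : Type*} {r : ℝ} (h0 : 0 ≤ r) (h1 : r ≤ 1)
    {μ : Measure (J → Bool)} (h : IsBernoulliProduct r μ) :
    μ = infinitePi fun _ ↦ _root_.bernoulliMeasure r := by
  have := isProbabilityMeasure_bernoulliMeasure h0 h1
  refine eq_infinitePi_of_forall_cylinder _ fun s b ↦ ?_
  rw [h.2]
  exact Finset.prod_congr rfl fun i _ ↦ (bernoulliMeasure_singleton r (b i)).symm

lemma infinitePi_bernoulliMeasure_holeAt {ι : Type*} [DecidableEq ι] [Fintype ι] {p : ℝ}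
    (h0 : 0 ≤ p) (h1 : p ≤ 1) (i : ι) :
    (infinitePi fun _ : ι ↦ _root_.bernoulliMeasure p) {holeAt i} =
      ENNReal.ofReal (1 - p) * ENNReal.ofReal p ^ (Fintype.card ι - 1) := by
  have := isProbabilityMeasure_bernoulliMeasure h0 h1
  rw [infinitePi_singleton_of_fintype, ← Finset.mul_prod_erase _ _ (Finset.mem_univ i),
    bernoulliMeasure_singleton, holeAt_self, Finset.prod_congr rfl (g := fun _ ↦ ENNReal.ofReal p),
    Finset.prod_const, Finset.card_erase_of_mem (Finset.mem_univ i), Finset.card_univ]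
  · simp
  · intro k hk
    rw [bernoulliMeasure_singleton, holeAt_of_ne (Finset.ne_of_mem_erase hk), if_pos rfl]

/-- The block length and the parameters of the noise used in a thickening by blocks. -/
lemma exists_noise_parameters {p p' : ℝ} (hp : 0 < p) (hpp' : p < p') (hp' : p' < 1) :
    ∃ (n : ℕ) (q θ : ℝ), q ∈ Icc 0 1 ∧ θ ∈ Icc 0 1 ∧ (1 - p) * (1 - q) = 1 - p' ∧
      p ^ n * (1 - p') + θ * ((p' - p) * p ^ n) = θ * ((p' - p) * p' ^ n) := by
  have h1p : 0 < 1 - p := by linarith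
  have hd : 0 < p' - p := by linarith
  have hp'0 : 0 < p' := hp.trans hpp'
  obtain ⟨n, hn⟩ := exists_pow_lt_of_lt_one (div_pos hd h1p) ((div_lt_one hp'0).2 hpp')
  rw [div_pow, div_lt_div_iff₀ (by positivity) h1p] at hn
  have hlt : p ^ n * (1 - p') ≤ (p' - p) * (p' ^ n - p ^ n) := by nlinarith
  have hpos : 0 < (p' - p) * (p' ^ n - p ^ n) :=
    (mul_pos (pow_pos hp n) (by linarith)).trans_le hlt
  refine ⟨n, (p' - p) / (1 - p), p ^ n * (1 - p') / ((p' - p) * (p' ^ n - p ^ n)),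
    ⟨by positivity, (div_le_one h1p).2 (by linarith)⟩,
    ⟨div_nonneg (mul_nonneg (pow_pos hp n).le (by linarith)) hpos.le, (div_le_one hpos).2 hlt⟩,
    ?_, ?_⟩
  · field_simp
    ring
  · have := div_mul_cancel₀ (p ^ n * (1 - p')) hpos.ne'
    linear_combination -this

/-- There is a monotone map between product measures on sequences of blocks. -/
lemma exists_block_thickening {p p' : ℝ} (hp : 0 < p) (hpp' : p < p') (hp' : p' < 1) :
    ∃ (n : ℕ) (f : (ℕ → Fin (n + 2) → Bool) → (ℕ → Fin (n + 2) → Bool)), Measurable f ∧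
      (infinitePi fun _ ↦ infinitePi fun _ ↦ _root_.bernoulliMeasure p).map f =
        (infinitePi fun _ ↦ infinitePi fun _ ↦ _root_.bernoulliMeasure p') ∧ ∀ x, x ≤ f x := by
  obtain ⟨n, q, θ, hq, hθ, hpq, hbal⟩ := exists_noise_parameters hp hpp' hp'
  have hp0 : p ∈ Icc 0 1 := ⟨hp.le, (hpp'.trans hp').le⟩
  have hp'0 : p' ∈ Icc 0 1 := ⟨(hp.trans hpp').le, hp'.le⟩
  have := isProbabilityMeasure_bernoulliMeasure hp0.1 hp0.2
  have := isProbabilityMeasure_bernoulliMeasure hp'0.1 hp'0.2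
  have := isProbabilityMeasure_bernoulliMeasure hq.1 hq.2
  have := isProbabilityMeasure_bernoulliMeasure hθ.1 hθ.2
  have hij : (0 : Fin (n + 2)) ≠ 1 := by simp
  have hD : (infinitePi fun _ : Fin (n + 2) ↦ _root_.bernoulliMeasure p)
      {w | w = holeAt 0 ∨ w = holeAt 1} ≠ 0 := by
    refine fun h ↦ ?_
    have h0 := measure_mono_null
      (show {holeAt 0} ⊆ {w : Fin (n + 2) → Bool | w = holeAt 0 ∨ w = holeAt 1} from
        fun w hw ↦ Or.inl hw) h
    rw [infinitePi_bernoulliMeasure_holeAt hp0.1 hp0.2] at h0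
    have h1 : ENNReal.ofReal (1 - p) ≠ 0 := by
      rw [Ne, ENNReal.ofReal_eq_zero]; linarith
    have h2 : ENNReal.ofReal p ≠ 0 := by
      rw [Ne, ENNReal.ofReal_eq_zero]; linarith
    exact mul_ne_zero h1 (pow_ne_zero _ h2) h0
  obtain ⟨f, hf, hmap, hle⟩ := exists_measurable_map_infinitePi
    (infinitePi fun _ : Fin (n + 2) ↦ _root_.bernoulliMeasure p)
    (infinitePi fun _ : Fin (n + 2) ↦ _root_.bernoulliMeasure p')
    ((infinitePi fun _ : Fin (n + 2) ↦ _root_.bernoulliMeasure q).prod (_root_.bernoulliMeasure θ))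
    hD (fun w ↦ w 0) (resample 0 1) (resample_mem_iff 0 1)
    (fun w hw b ↦ by
      rw [resample, if_pos (show w = holeAt 0 ∨ w = holeAt 1 from hw)]
      cases b <;> simp [holeAt])
    (prod_map_resample hij _ (by
      rw [infinitePi_bernoulliMeasure_holeAt hp0.1 hp0.2,
        infinitePi_bernoulliMeasure_holeAt hp0.1 hp0.2]))
    (fill 0 1) (fill_resample 0 1)
    (prod_map_fill hij hp0 hp'0 hq hθ hpq (by simpa using hbal))
  refine ⟨n, f, hf, hmap, fun x k ↦ ?_⟩
  obtain ⟨y, hy⟩ := hle x k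
  rw [hy]
  exact le_fill 0 1 (x k) y

lemma exists_thickening {p p' : ℝ} (hp : 0 < p) (hpp' : p < p') (hp' : p' < 1) (J : Type*)
    [Countable J] [Infinite J] :
    ∃ f : (J → Bool) → (J → Bool), Measurable f ∧
      (infinitePi fun _ ↦ _root_.bernoulliMeasure p).map f =
        (infinitePi fun _ ↦ _root_.bernoulliMeasure p') ∧ ∀ x, x ≤ f x := by
  obtain ⟨n, f, hf, hmap, hle⟩ := exists_block_thickening hp hpp' hp'
  have := isProbabilityMeasure_bernoulliMeasure hp.le (hpp'.trans hp').le
  have := isProbabilityMeasure_bernoulliMeasure (hp.trans hpp').le hp'.le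
  obtain ⟨e⟩ : Nonempty (J ≃ ℕ × Fin (n + 2)) := nonempty_equiv_of_countable
  let c := MeasurableEquiv.curry ℕ (Fin (n + 2)) Bool
  have hin : Measurable fun (x : J → Bool) k ↦ x (e.symm k) := by fun_prop
  have hout : Measurable fun (x : ℕ × Fin (n + 2) → Bool) k ↦ x (e k) := by fun_prop
  refine ⟨fun x k ↦ c.symm (f (c fun k ↦ x (e.symm k))) (e k),
    hout.comp (c.symm.measurable.comp (hf.comp (c.measurable.comp hin))), ?_, fun x k ↦ ?_⟩
  · have hcomp : (fun (x : J → Bool) k ↦ c.symm (f (c fun k ↦ x (e.symm k))) (e k)) =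
        (fun (x : ℕ × Fin (n + 2) → Bool) k ↦ x (e k)) ∘ c.symm ∘ f ∘ c ∘
          fun (x : J → Bool) k ↦ x (e.symm k) := rfl
    rw [hcomp, ← Measure.map_map hout (by fun_prop), ← Measure.map_map (by fun_prop) (by fun_prop),
      ← Measure.map_map hf (by fun_prop), ← Measure.map_map (by fun_prop) hin,
      map_infinitePi_infinitePi_of_inj e.symm.injective,
      infinitePi_map_curry (fun _ _ ↦ _root_.bernoulliMeasure p), hmap,
      infinitePi_map_curry_symm (fun _ _ ↦ _root_.bernoulliMeasure p'),
      map_infinitePi_infinitePi_of_inj e.injective]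
  · have := hle (c fun k ↦ x (e.symm k)) (e k).1 (e k).2
    simpa [c, MeasurableEquiv.curry, Function.curry, Function.uncurry] using this

end Thickening

/-- For every `0 < p < p' < 1` there exists a discrete thickening from density `p`
to density `p'` on `{0,1}^ℤ`. -/
theorem discrete_thickening_exists (p p' : ℝ) (hp : 0 < p) (hpp' : p < p') (hp' : p' < 1) :
    ∃ f : (ℤ → Bool) → (ℤ → Bool), Measurable f ∧
      ∀ μ : Measure (ℤ → Bool), IsBernoulliProduct p μ →
        IsBernoulliProduct p' (μ.map f) ∧ ∀ᵐ x ∂μ, ∀ i : ℤ, x i ≤ f x i := by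
  have hp1 : p ≤ 1 := (hpp'.trans hp').le
  obtain ⟨f, hf, hmap, hle⟩ := Thickening.exists_thickening hp hpp' hp' ℤ
  refine ⟨f, hf, fun μ hμ ↦ ?_⟩
  rw [Thickening.eq_infinitePi_of_isBernoulliProduct hp.le hp1 hμ, hmap]
  exact ⟨Thickening.isBernoulliProduct_infinitePi (hp.trans hpp').le hp'.le,
    Filter.Eventually.of_forall hle⟩
end

section
/- Let d ≥ 1 and 0 < p < p' < 1 with max(p, 1−p) < p'. Then there exists a discrete thickening from density p to density p' on {0,1}^{ℤ^d} which commutes with all shifts of ℤ^d, i.e., a measurable f : {0,1}^{ℤ^d} → {0,1}^{ℤ^d} pushing Bernoulli(p)^{ℤ^d} forward to Bernoulli(p')^{ℤ^d}, satisfying f(x)_i ≥ x_i for all i ∈ ℤ^d for almost every x, and satisfying f ∘ σ_v = σ_v ∘ f for every v ∈ ℤ^d. -/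
open MeasureTheory ProbabilityTheory

section Driven

variable {S : Type*}

/-- The state at time `t + n` of the system driven by the symbols of `x` through the maps `g`,
when the state at time `t` is `s`. -/
def drivenState (g : Bool → S → S) (x : ℤ → Bool) : ℕ → ℤ → S → S
  | 0, _, s => s
  | n + 1, t, s => drivenState g x n (t + 1) (g (x t) s)

lemma drivenState_add (g : Bool → S → S) (x : ℤ → Bool) (m n : ℕ) (t : ℤ) (s : S) :
    drivenState g x (n + m) t s = drivenState g x m (t + n) (drivenState g x n t s) := by
  induction n generalizing t s with
  | zero => simp [drivenState]
  | succ n ih =>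
    rw [Nat.add_right_comm]
    simp only [drivenState, ih]
    congr 1
    push_cast
    ring

lemma drivenState_update (g : Bool → S → S) (x : ℤ → Bool) {k t : ℤ} (h : k < t) (c : Bool)
    (n : ℕ) (s : S) :
    drivenState g (Function.update x k c) n t s = drivenState g x n t s := by
  induction n generalizing t s with
  | zero => rfl
  | succ n ih =>
    simp only [drivenState]
    rw [ih (by lia), Function.update_of_ne h.ne']

lemma drivenState_shift (g : Bool → S → S) (x : ℤ → Bool) (j : ℤ) (n : ℕ) (t : ℤ) (s : S) :
    drivenState g (fun k => x (k + j)) n t s = drivenState g x n (t + j) s := by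
  induction n generalizing t s with
  | zero => rfl
  | succ n ih =>
    simp only [drivenState]
    rw [ih, add_right_comm]

lemma measurable_uncurry_of_bool {α β : Type*} [MeasurableSpace α] [MeasurableSpace β]
    {f : Bool → α → β} (hf : ∀ c, Measurable (f c)) : Measurable (Function.uncurry f) :=
  measurable_from_prod_countable_right hf

lemma measurable_drivenState [MeasurableSpace S] {g : Bool → S → S} (hg : ∀ c, Measurable (g c))
    {α : Type*} [MeasurableSpace α] {u : α → ℤ → Bool} {v : α → S} (hu : Measurable u)
    (hv : Measurable v) (n : ℕ) (t : ℤ) :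
    Measurable fun a => drivenState g (u a) n t (v a) := by
  induction n generalizing t v with
  | zero => exact hv
  | succ n ih =>
    refine ih (v := fun a => g (u a t) (v a)) ?_ (t + 1)
    exact (measurable_uncurry_of_bool hg).comp
      (((measurable_pi_apply t).comp hu).prodMk hv)

end Driven

/-- The discrete metric on `Bool` with values in `ℝ≥0∞`. -/
def boolDist (a b : Bool) : ENNReal := if a = b then 0 else 1

lemma boolDist_le_one (a b : Bool) : boolDist a b ≤ 1 := by
  unfold boolDist; split_ifs <;> simp

lemma boolDist_comm (a b : Bool) : boolDist a b = boolDist b a := by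
  simp [boolDist, eq_comm]

lemma boolDist_triangle (a b c : Bool) : boolDist a c ≤ boolDist a b + boolDist b c := by
  cases a <;> cases b <;> cases c <;> simp [boolDist]

lemma Measurable.boolDist {α : Type*} [MeasurableSpace α] {u v : α → Bool} (hu : Measurable u)
    (hv : Measurable v) : Measurable fun a => boolDist (u a) (v a) :=
  (measurable_of_countable (fun z : Bool × Bool => _root_.boolDist z.1 z.2)).comp (hu.prodMk hv)

lemma lintegral_infinitePi_update (P : Measure Bool) [IsProbabilityMeasure P] (t : ℤ)
    {Φ : (ℤ → Bool) → ENNReal} (hΦ : Measurable Φ) :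
    ∫⁻ x, Φ x ∂Measure.infinitePi (fun _ : ℤ => P) =
      ∫⁻ c, ∫⁻ x, Φ (Function.update x t c) ∂Measure.infinitePi (fun _ : ℤ => P) ∂P := by
  have hm : Measurable fun z : Bool × (ℤ → Bool) => Function.update z.2 t z.1 := by
    refine measurable_pi_lambda _ fun i => ?_
    by_cases h : i = t
    · subst h; simpa using measurable_fst
    · simp only [Function.update_of_ne h]
      fun_prop
  have key : (P.prod (Measure.infinitePi fun _ : ℤ => P)).map
      (fun z : Bool × (ℤ → Bool) => Function.update z.2 t z.1) =
        Measure.infinitePi fun _ : ℤ => P := by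
    refine Measure.eq_infinitePi _ fun s u hu => ?_
    rw [Measure.map_apply hm (.pi s.countable_toSet fun _ _ => hu _)]
    have : (fun z : Bool × (ℤ → Bool) => Function.update z.2 t z.1) ⁻¹' (s : Set ℤ).pi u =
        (if t ∈ s then u t else Set.univ) ×ˢ ((s.erase t : Finset ℤ) : Set ℤ).pi u := by
      ext ⟨c, x⟩
      simp only [Set.mem_preimage, Set.mem_pi, Set.mem_prod, Finset.mem_coe, Finset.mem_erase]
      constructor
      · intro h
        refine ⟨?_, fun i hi => by simpa [Function.update_of_ne hi.1] using h i hi.2⟩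
        split_ifs with ht
        · simpa using h t ht
        · trivial
      · rintro ⟨h1, h2⟩ i hi
        by_cases h : i = t
        · subst h; simpa [hi] using h1
        · simpa [Function.update_of_ne h] using h2 i ⟨h, hi⟩
    rw [this, Measure.prod_prod, Measure.infinitePi_pi _ fun i _ => hu i]
    split_ifs with ht
    · rw [Finset.mul_prod_erase s (fun i => P (u i)) ht]
    · rw [measure_univ, one_mul, Finset.erase_eq_of_notMem ht]
  conv_lhs => rw [← key]
  rw [lintegral_map hΦ hm]
  exact lintegral_prod _ (hΦ.comp hm).aemeasurable

lemma lintegral_step {S : Type*} [MeasurableSpace S] {P P' : Measure Bool} {ρ : Measure S}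
    [SFinite ρ] {g : Bool → S → S} {o : Bool → S → Bool} (hg : ∀ c, Measurable (g c))
      (ho : ∀ c, Measurable (o c))
    (H : (P.prod ρ).map (fun z => (o z.1 z.2, g z.1 z.2)) = P'.prod ρ)
    (ψ : Bool → ENNReal) {Φ : S → ENNReal} (hΦ : Measurable Φ) :
    ∫⁻ c, ∫⁻ s, ψ (o c s) * Φ (g c s) ∂ρ ∂P = (∫⁻ b, ψ b ∂P') * ∫⁻ s, Φ s ∂ρ := by
  have hψ : Measurable ψ := measurable_of_countable ψ
  have hm : Measurable fun z : Bool × S => (o z.1 z.2, g z.1 z.2) :=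
    (measurable_uncurry_of_bool ho).prodMk (measurable_uncurry_of_bool hg)
  have hF : Measurable fun z : Bool × S => ψ z.1 * Φ z.2 :=
    (hψ.comp measurable_fst).mul (hΦ.comp measurable_snd)
  rw [← lintegral_prod_mul hψ.aemeasurable hΦ.aemeasurable, ← H, lintegral_map hF hm]
  exact (lintegral_prod _ (hF.comp hm).aemeasurable).symm

section Law

variable {S : Type*} [MeasurableSpace S] {P P' : Measure Bool} [IsProbabilityMeasure P]
  {ρ : Measure S} [IsProbabilityMeasure ρ] {g : Bool → S → S} {o : Bool → S → Bool}

lemma lintegral_drivenState [IsProbabilityMeasure P'] (hg : ∀ c, Measurable (g c))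
    (ho : ∀ c, Measurable (o c))
    (H : (P.prod ρ).map (fun z => (o z.1 z.2, g z.1 z.2)) = P'.prod ρ)
    {Φ : (ℤ → Bool) → S → ENNReal} (hΦ : Measurable (Function.uncurry Φ)) (n : ℕ) (t : ℤ)
    (hinv : ∀ k c x, k < t + n → Φ (Function.update x k c) = Φ x) :
    ∫⁻ x, ∫⁻ s, Φ x (drivenState g x n t s) ∂ρ ∂Measure.infinitePi (fun _ : ℤ => P) =
      ∫⁻ x, ∫⁻ s, Φ x s ∂ρ ∂Measure.infinitePi (fun _ : ℤ => P) := by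
  induction n generalizing t with
  | zero => rfl
  | succ n ih =>
    have hm : ∀ n t, Measurable fun z : (ℤ → Bool) × S => Φ z.1 (drivenState g z.1 n t z.2) :=
      fun n t => hΦ.comp (measurable_fst.prodMk
        (measurable_drivenState hg measurable_fst measurable_snd n t))
    rw [lintegral_infinitePi_update P t (hm (n + 1) t).lintegral_prod_right']
    simp only [drivenState, Function.update_self, drivenState_update g _ (lt_add_one t)]
    simp only [fun c x => hinv t c x (by push_cast; lia)]
    rw [lintegral_lintegral_swap]
    · rw [← ih (t + 1) fun k c x hk => hinv k c x (by push_cast; lia)]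
      refine lintegral_congr fun x => ?_
      have := lintegral_step hg ho H (fun _ => 1)
        (Φ := fun s => Φ x (drivenState g x n (t + 1) s))
          ((hm n (t + 1)).comp measurable_prodMk_left)
      rw [lintegral_one, measure_univ, one_mul] at this
      simpa only [one_mul] using this
    · refine Measurable.aemeasurable ?_
      refine measurable_uncurry_of_bool fun c => ?_
      exact ((hm n (t + 1)).comp
        (measurable_fst.prodMk ((hg c).comp measurable_snd))).lintegral_prod_right'

lemma lintegral_prod_output (hg : ∀ c, Measurable (g c)) (ho : ∀ c, Measurable (o c))
    (H : (P.prod ρ).map (fun z => (o z.1 z.2, g z.1 z.2)) = P'.prod ρ)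
    (ψ : ℤ → Bool → ENNReal) (n : ℕ) (t : ℤ) :
    ∫⁻ x, ∫⁻ s, ∏ k ∈ Finset.range n, ψ (t + k) (o (x (t + k)) (drivenState g x k t s)) ∂ρ
        ∂Measure.infinitePi (fun _ : ℤ => P) =
      ∏ k ∈ Finset.range n, ∫⁻ b, ψ (t + k) b ∂P' := by
  induction n generalizing t with
  | zero => simp
  | succ n ih =>
    have hm : ∀ n t, Measurable fun z : (ℤ → Bool) × S =>
        ∏ k ∈ Finset.range n, ψ (t + k) (o (z.1 (t + k)) (drivenState g z.1 k t z.2)) := by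
      intro n t
      refine Finset.measurable_fun_prod _ fun k _ => ?_
      refine (measurable_of_countable (ψ (t + k))).comp ?_
      exact (measurable_uncurry_of_bool ho).comp
        (((measurable_pi_apply (t + k : ℤ)).comp measurable_fst).prodMk
          (measurable_drivenState hg measurable_fst measurable_snd k t))
    rw [lintegral_infinitePi_update P t (hm (n + 1) t).lintegral_prod_right']
    have e : ∀ k : ℕ, t + ((k + 1 : ℕ) : ℤ) = t + 1 + k := fun k => by push_cast; ring
    have hne : ∀ k : ℕ, t + 1 + (k : ℤ) ≠ t := fun k => by lia
    simp only [Finset.prod_range_succ', drivenState, Function.update_self,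
      drivenState_update g _ (lt_add_one t), e, Nat.cast_zero, add_zero,
      Function.update_of_ne (hne _)]
    rw [lintegral_lintegral_swap]
    · rw [← ih (t + 1), mul_comm, ← lintegral_const_mul _ (hm n (t + 1)).lintegral_prod_right']
      refine lintegral_congr fun x => ?_
      rw [← lintegral_step hg ho H (ψ t)
        (Φ := fun s => ∏ k ∈ Finset.range n,
          ψ (t + 1 + k) (o (x (t + 1 + k)) (drivenState g x k (t + 1) s)))
        ((hm n (t + 1)).comp measurable_prodMk_left)]
      simp only [mul_comm]
    · refine Measurable.aemeasurable ?_
      refine measurable_uncurry_of_bool fun c => ?_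
      exact Measurable.lintegral_prod_right'
        (((hm n (t + 1)).comp (measurable_fst.prodMk ((hg c).comp measurable_snd))).mul
          ((measurable_of_countable (ψ t)).comp ((ho c).comp measurable_snd)))

end Law
lemma exists_measurable_limit {Ω : Type*} [MeasurableSpace Ω] (μ : Measure Ω)
    (Y : ℕ → Ω → Bool) (hY : ∀ k, Measurable (Y k)) :
    ∃ φ : Ω → Bool, Measurable φ ∧ (∀ ω, (∀ k, Y k ω = true) → φ ω = true) ∧
      ∀ k, ∫⁻ ω, boolDist (φ ω) (Y k ω) ∂μ ≤
        ∑' j, ∫⁻ ω, boolDist (Y (j + k) ω) (Y (j + k + 1) ω) ∂μ := by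
  classical
  let A : Set Ω := ⋃ K, ⋂ k, Y (k + K) ⁻¹' {true}
  have hA : MeasurableSet A :=
    .iUnion fun K => .iInter fun k => hY _ (measurableSet_singleton true)
  refine ⟨fun ω => decide (ω ∈ A), ?_, fun ω h => ?_, fun k => ?_⟩
  · refine measurable_to_bool ?_
    convert hA
    ext ω
    simp
  · simp [A, h]
  · rw [← lintegral_tsum fun j => ((hY _).boolDist (hY _)).aemeasurable]
    refine lintegral_mono fun ω => ?_
    by_cases h : ∀ j, Y (j + k) ω = Y (j + k + 1) ω
    · have hc : ∀ j, Y (j + k) ω = Y k ω := by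
        intro j
        induction j with
        | zero => simp
        | succ j ih => rw [← ih, h j]; congr 1; lia
      have : decide (ω ∈ A) = Y k ω := by
        cases hk : Y k ω
        · simp only [A, decide_eq_false_iff_not, Set.mem_iUnion, Set.mem_iInter,
            Set.mem_preimage, Set.mem_singleton_iff, not_exists, not_forall]
          intro K
          refine ⟨k, ?_⟩
          rw [add_comm, hc K, hk]
          simp
        · simp only [A, decide_eq_true_eq, Set.mem_iUnion, Set.mem_iInter,
            Set.mem_preimage, Set.mem_singleton_iff]
          exact ⟨k, fun j => by rw [hc j, hk]⟩
      simp [boolDist, this]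
    · push Not at h
      obtain ⟨j, hj⟩ := h
      refine (boolDist_le_one _ _).trans (le_trans ?_ (ENNReal.le_tsum j))
      simp [boolDist, hj]

section Factor

open Filter Topology

variable {S : Type*} [MeasurableSpace S] {P P' : Measure Bool} [IsProbabilityMeasure P]
  [IsProbabilityMeasure P'] {ρ : Measure S} [IsProbabilityMeasure ρ] {g : Bool → S → S}
  {o : Bool → S → Bool}

/-- The symbol emitted at time `0` by the driven system started from `s` at time `-n`. -/
def emitted (g : Bool → S → S) (o : Bool → S → Bool) (n : ℕ) (x : ℤ → Bool) (s : S) : Bool :=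
  o (x 0) (drivenState g x n (-n) s)

lemma measurable_emitted (hg : ∀ c, Measurable (g c)) (ho : ∀ c, Measurable (o c)) (n : ℕ)
    {α : Type*} [MeasurableSpace α] {u : α → ℤ → Bool} {v : α → S} (hu : Measurable u)
    (hv : Measurable v) : Measurable fun a => emitted g o n (u a) (v a) :=
  (measurable_uncurry_of_bool ho).comp
    (((measurable_pi_apply 0).comp hu).prodMk (measurable_drivenState hg hu hv n _))

lemma lintegral_emitted_dist (hg : ∀ c, Measurable (g c)) (ho : ∀ c, Measurable (o c))
    (H : (P.prod ρ).map (fun z => (o z.1 z.2, g z.1 z.2)) = P'.prod ρ) (s₀ : S) {n m : ℕ}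
    (h : n ≤ m) :
    ∫⁻ x, ∫⁻ s, boolDist (emitted g o n x s₀) (emitted g o m x s) ∂ρ
        ∂Measure.infinitePi (fun _ : ℤ => P) =
      ∫⁻ x, ∫⁻ s, boolDist (emitted g o n x s₀) (emitted g o n x s) ∂ρ
        ∂Measure.infinitePi (fun _ : ℤ => P) := by
  obtain ⟨k, rfl⟩ := Nat.exists_eq_add_of_le' h
  rw [← lintegral_drivenState hg ho H
    (Φ := fun x s => boolDist (emitted g o n x s₀) (emitted g o n x s)) ?_ k (-(k + n : ℕ) : ℤ)]
  · have : (-((k + n : ℕ) : ℤ) + k) = -n := by push_cast; ring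
    simp only [emitted, drivenState_add, this]
  · intro j c x hj
    have hj' : j < -(n : ℤ) := by push_cast at hj; lia
    ext s
    simp only [emitted, drivenState_update g x hj', Function.update_of_ne (show (0 : ℤ) ≠ j by lia)]
  · exact (measurable_emitted hg ho n measurable_fst measurable_const).boolDist
      (measurable_emitted hg ho n measurable_fst measurable_snd)

lemma exists_emitted_limit (hg : ∀ c, Measurable (g c)) (ho : ∀ c, Measurable (o c))
    (H : (P.prod ρ).map (fun z => (o z.1 z.2, g z.1 z.2)) = P'.prod ρ)
    (hsync : Tendsto (fun n : ℕ => ∫⁻ s, ∫⁻ s', ∫⁻ x, boolDist (emitted g o n x s)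
      (emitted g o n x s') ∂Measure.infinitePi (fun _ : ℤ => P) ∂ρ ∂ρ) atTop (𝓝 0))
    (hle : ∀ s, o true s = true) :
    ∃ φ : (ℤ → Bool) → Bool, Measurable φ ∧ (∀ x, x 0 ≤ φ x) ∧
      Tendsto (fun n : ℕ => ∫⁻ x, ∫⁻ s, boolDist (φ x) (emitted g o n x s) ∂ρ
        ∂Measure.infinitePi (fun _ : ℤ => P)) atTop (𝓝 0) := by
  set μ := Measure.infinitePi (fun _ : ℤ => P) with hμ
  have hstart : ∀ n, ∃ s, ∫⁻ x, ∫⁻ s', boolDist (emitted g o n x s) (emitted g o n x s') ∂ρ ∂μ ≤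
      ∫⁻ s, ∫⁻ s', ∫⁻ x, boolDist (emitted g o n x s) (emitted g o n x s') ∂μ ∂ρ ∂ρ := by
    intro n
    have hm : Measurable fun z : (S × S) × (ℤ → Bool) =>
        boolDist (emitted g o n z.2 z.1.1) (emitted g o n z.2 z.1.2) :=
      (measurable_emitted hg ho n measurable_snd (measurable_fst.comp measurable_fst)).boolDist
        (measurable_emitted hg ho n measurable_snd (measurable_snd.comp measurable_fst))
    obtain ⟨s, hs⟩ := exists_le_lintegral (μ := ρ)
      (f := fun s => ∫⁻ s', ∫⁻ x, boolDist (emitted g o n x s) (emitted g o n x s') ∂μ ∂ρ)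
      hm.lintegral_prod_right'.lintegral_prod_right'.aemeasurable
    refine ⟨s, le_of_eq_of_le ?_ hs⟩
    refine lintegral_lintegral_swap (f := fun x s' =>
      boolDist (emitted g o n x s) (emitted g o n x s')) ?_
    exact (hm.comp ((measurable_const (a := s)).prodMk measurable_snd |>.prodMk
      measurable_fst)).aemeasurable
  obtain ⟨N, hN, hN'⟩ := extraction_forall_of_eventually (fun k : ℕ =>
    hsync.eventually (gt_mem_nhds (show (0 : ENNReal) < 2⁻¹ ^ k from
      ENNReal.pow_pos (by simp) k)))
  choose s₀ hs₀ using hstart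
  let Y : ℕ → (ℤ → Bool) → Bool := fun k x => emitted g o (N k) x (s₀ (N k))
  have hY : ∀ k, Measurable (Y k) := fun k =>
    measurable_emitted hg ho (N k) measurable_id measurable_const
  have hYZm : ∀ k n, Measurable fun z : (ℤ → Bool) × S =>
      boolDist (Y k z.1) (emitted g o n z.1 z.2) := fun k n =>
    ((hY k).comp measurable_fst).boolDist (measurable_emitted hg ho n measurable_fst measurable_snd)
  have hYZ : ∀ k n, N k ≤ n →
      ∫⁻ x, ∫⁻ s, boolDist (Y k x) (emitted g o n x s) ∂ρ ∂μ ≤ 2⁻¹ ^ k := fun k n h =>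
    (lintegral_emitted_dist hg ho H _ h).trans_le ((hs₀ _).trans (hN' k).le)
  have hYY : ∀ k, ∫⁻ x, boolDist (Y k x) (Y (k + 1) x) ∂μ ≤ 2⁻¹ ^ k + 2⁻¹ ^ k := by
    intro k
    calc ∫⁻ x, boolDist (Y k x) (Y (k + 1) x) ∂μ
        = ∫⁻ x, ∫⁻ _s, boolDist (Y k x) (Y (k + 1) x) ∂ρ ∂μ := by simp
      _ ≤ ∫⁻ x, ∫⁻ s, boolDist (Y k x) (emitted g o (N (k + 1)) x s) +
            boolDist (Y (k + 1) x) (emitted g o (N (k + 1)) x s) ∂ρ ∂μ := by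
          gcongr with x s
          rw [boolDist_comm (Y (k + 1) x)]
          exact boolDist_triangle _ _ _
      _ = ∫⁻ x, ((∫⁻ s, boolDist (Y k x) (emitted g o (N (k + 1)) x s) ∂ρ) +
            ∫⁻ s, boolDist (Y (k + 1) x) (emitted g o (N (k + 1)) x s) ∂ρ) ∂μ := by
          refine lintegral_congr fun x => ?_
          exact lintegral_add_left ((hYZm k (N (k + 1))).comp measurable_prodMk_left) _
      _ ≤ 2⁻¹ ^ k + 2⁻¹ ^ (k + 1) := by
          rw [lintegral_add_left (hYZm k (N (k + 1))).lintegral_prod_right']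
          exact add_le_add (hYZ k _ (hN.monotone k.le_succ)) (hYZ _ _ le_rfl)
      _ ≤ _ := by
          refine add_le_add le_rfl ?_
          rw [pow_succ]
          exact mul_le_of_le_one_right' (by simp)
  obtain ⟨φ, hφ, hφ1, hφ2⟩ := exists_measurable_limit μ Y hY
  refine ⟨φ, hφ, fun x => ?_, ?_⟩
  · cases hx : x 0
    · exact Bool.false_le _
    · rw [hφ1 x fun k => by simp [Y, emitted, hx, hle]]
  · have htail : Tendsto (fun k => (∑' j, ∫⁻ x, boolDist (Y (j + k) x) (Y (j + k + 1) x) ∂μ) +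
        2⁻¹ ^ k) atTop (𝓝 0) := by
      rw [← add_zero (0 : ENNReal)]
      refine Tendsto.add (ENNReal.tendsto_sum_nat_add
        (fun j => ∫⁻ x, boolDist (Y j x) (Y (j + 1) x) ∂μ) ?_)
        (ENNReal.tendsto_pow_atTop_nhds_zero_of_lt_one (by simp))
      refine ne_top_of_le_ne_top ?_ (ENNReal.tsum_le_tsum hYY)
      rw [ENNReal.tsum_add, ENNReal.tsum_geometric]
      simp [ENNReal.one_sub_inv_two]
    rw [ENNReal.tendsto_nhds_zero]
    intro ε hε
    obtain ⟨k, hk⟩ := (htail.eventually (ge_mem_nhds hε)).exists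
    filter_upwards [eventually_ge_atTop (N k)] with n hn
    refine le_trans ?_ hk
    calc ∫⁻ x, ∫⁻ s, boolDist (φ x) (emitted g o n x s) ∂ρ ∂μ
        ≤ ∫⁻ x, ∫⁻ s, boolDist (φ x) (Y k x) + boolDist (Y k x) (emitted g o n x s) ∂ρ ∂μ := by
          gcongr with x s
          exact boolDist_triangle _ _ _
      _ = ∫⁻ x, (boolDist (φ x) (Y k x) +
            ∫⁻ s, boolDist (Y k x) (emitted g o n x s) ∂ρ) ∂μ := by
          refine lintegral_congr fun x => ?_
          rw [lintegral_add_left measurable_const]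
          simp
      _ ≤ _ := by
          rw [lintegral_add_left (hφ.boolDist (hY k))]
          exact add_le_add (hφ2 k) (hYZ k n hn)

lemma prod_indicator_le_add_sum_boolDist (F : Finset ℤ) (t : ℤ → Set Bool) (a b : ℤ → Bool) :
    ∏ i ∈ F, (t i).indicator (fun _ => (1 : ENNReal)) (a i) ≤
      ∏ i ∈ F, (t i).indicator (fun _ => (1 : ENNReal)) (b i) + ∑ i ∈ F, boolDist (a i) (b i) := by
  by_cases h : ∀ i ∈ F, a i = b i
  · exact (Finset.prod_congr rfl fun i hi => by rw [h i hi]).le.trans le_self_add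
  · push Not at h
    obtain ⟨i, hi, hne⟩ := h
    calc ∏ i ∈ F, (t i).indicator (fun _ => (1 : ENNReal)) (a i) ≤ 1 :=
          Finset.prod_le_one' fun i _ => Set.indicator_le_self' (by simp) _
      _ = boolDist (a i) (b i) := by simp [boolDist, hne]
      _ ≤ ∑ i ∈ F, boolDist (a i) (b i) :=
          Finset.single_le_sum (f := fun i => boolDist (a i) (b i)) (fun _ _ => zero_le) hi
      _ ≤ _ := le_add_self

lemma measurePreserving_shift (P : Measure Bool) [IsProbabilityMeasure P] (i : ℤ) :
    MeasurePreserving (fun (x : ℤ → Bool) k => x (k + i)) (Measure.infinitePi fun _ : ℤ => P)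
      (Measure.infinitePi fun _ : ℤ => P) :=
  ⟨by fun_prop, Measure.map_infinitePi_infinitePi_of_inj (P := fun _ : ℤ => P)
    (add_left_injective i)⟩

lemma emitted_shift {S : Type*} (g : Bool → S → S) (o : Bool → S → Bool) (x : ℤ → Bool) (n : ℕ)
    (t i : ℤ)
    (h : t + n = i) (s : S) :
    emitted g o n (fun k => x (k + i)) s = o (x i) (drivenState g x n t s) := by
  subst h
  simp only [emitted, drivenState_shift]
  simp

lemma lintegral_prod_output_finset (hg : ∀ c, Measurable (g c)) (ho : ∀ c, Measurable (o c))
    (H : (P.prod ρ).map (fun z => (o z.1 z.2, g z.1 z.2)) = P'.prod ρ)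
    (F : Finset ℤ) (t : ℤ) (hF : ∀ i ∈ F, t ≤ i) (ψ : ℤ → Bool → ENNReal) :
    ∫⁻ x, ∫⁻ s, ∏ i ∈ F, ψ i (o (x i) (drivenState g x (i - t).toNat t s)) ∂ρ
        ∂Measure.infinitePi (fun _ : ℤ => P) = ∏ i ∈ F, ∫⁻ b, ψ i b ∂P' := by
  obtain ⟨n, hn⟩ : ∃ n : ℕ, ∀ i ∈ F, i < t + n := by
    obtain ⟨M, hM⟩ := F.bddAbove
    exact ⟨(M + 1 - t).toNat, fun i hi => by have := hM hi; lia⟩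
  have hprod : ∀ h : ℤ → ENNReal, ∏ i ∈ F, h i =
      ∏ k ∈ Finset.range n, (if t + (k : ℤ) ∈ F then h (t + k) else 1) := by
    intro h
    have e : (Finset.range n).image (fun k : ℕ => t + (k : ℤ)) = Finset.Ico t (t + n) := by
      ext i
      simp only [Finset.mem_image, Finset.mem_range, Finset.mem_Ico]
      exact ⟨by rintro ⟨k, hk, rfl⟩; lia, fun hi => ⟨(i - t).toNat, by lia, by lia⟩⟩
    rw [← Finset.prod_image (f := fun i => if i ∈ F then h i else 1)
      (g := fun k : ℕ => t + (k : ℤ)) (fun a _ b _ hab => by simpa using hab), e,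
      Finset.prod_ite_mem, Finset.inter_eq_right.mpr]
    exact fun i hi => Finset.mem_Ico.mpr ⟨hF i hi, hn i hi⟩
  have key := lintegral_prod_output hg ho H (fun i b => if i ∈ F then ψ i b else 1) n t
  simp only [hprod]
  convert! key using 1
  · refine lintegral_congr fun x => lintegral_congr fun s => Finset.prod_congr rfl fun k _ => ?_
    simp
  · refine Finset.prod_congr rfl fun k _ => ?_
    split_ifs
    · rfl
    · rw [lintegral_one, measure_univ]

theorem exists_equivariant_factor (hg : ∀ c, Measurable (g c)) (ho : ∀ c, Measurable (o c))
    (H : (P.prod ρ).map (fun z => (o z.1 z.2, g z.1 z.2)) = P'.prod ρ)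
    (hsync : Tendsto (fun n : ℕ => ∫⁻ s, ∫⁻ s', ∫⁻ x, boolDist (emitted g o n x s)
      (emitted g o n x s') ∂Measure.infinitePi (fun _ : ℤ => P) ∂ρ ∂ρ) atTop (𝓝 0))
    (hle : ∀ s, o true s = true) :
    ∃ φ : (ℤ → Bool) → Bool, Measurable φ ∧ (∀ x, x 0 ≤ φ x) ∧
      (Measure.infinitePi fun _ : ℤ => P).map (fun x i => φ fun k => x (k + i)) =
        Measure.infinitePi fun _ : ℤ => P' := by
  obtain ⟨φ, hφ, hφ0, hlim⟩ := exists_emitted_limit hg ho H hsync hle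
  refine ⟨φ, hφ, hφ0, ?_⟩
  set μ := Measure.infinitePi (fun _ : ℤ => P) with hμ
  have hf : Measurable fun (x : ℤ → Bool) (i : ℤ) => φ fun k => x (k + i) :=
    measurable_pi_lambda _ fun i => hφ.comp (measurePreserving_shift P i).measurable
  refine Measure.eq_infinitePi _ fun F u hu => ?_
  rw [Measure.map_apply hf (.pi F.countable_toSet fun _ _ => hu _)]
  let I : ℤ → Bool → ENNReal := fun i => (u i).indicator fun _ => 1
  have hI : ∀ i, Measurable (I i) := fun i => measurable_of_countable _
  have hshift : ∀ i, Measurable fun x : ℤ → Bool => φ fun k => x (k + i) := fun i =>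
    (measurable_pi_apply i).comp hf
  have hL : μ ((fun (x : ℤ → Bool) (i : ℤ) => φ fun k => x (k + i)) ⁻¹' (F : Set ℤ).pi u) =
      ∫⁻ x, ∫⁻ _s, ∏ i ∈ F, I i (φ fun k => x (k + i)) ∂ρ ∂μ := by
    rw [← lintegral_indicator_one (hf (.pi F.countable_toSet fun _ _ => hu _))]
    refine lintegral_congr fun x => ?_
    rw [lintegral_const, measure_univ, mul_one]
    classical
    simp only [I, Set.indicator_apply, Set.mem_preimage, Set.mem_pi, Finset.mem_coe,
      Pi.one_apply, Finset.prod_ite_zero, Finset.prod_const_one]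
  have hR : ∀ N : ℕ, (∀ i ∈ F, -(N : ℤ) ≤ i) → ∫⁻ x, ∫⁻ s, ∏ i ∈ F,
      I i (o (x i) (drivenState g x (i - -(N : ℤ)).toNat (-N) s)) ∂ρ ∂μ = ∏ i ∈ F, P' (u i) := by
    intro N hN
    rw [lintegral_prod_output_finset hg ho H F (-N) hN I]
    exact Finset.prod_congr rfl fun i _ => lintegral_indicator_one (hu i)
  let E : ℕ → ENNReal := fun N => ∑ i ∈ F, ∫⁻ x, ∫⁻ s, boolDist (φ x)
    (emitted g o (i - -(N : ℤ)).toNat x s) ∂ρ ∂μ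
  have hE : Tendsto E atTop (𝓝 0) := by
    rw [← Finset.sum_const_zero (s := F) (M := ENNReal)]
    refine tendsto_finsetSum _ fun i _ => hlim.comp ?_
    refine tendsto_atTop.mpr fun b => ?_
    filter_upwards [eventually_ge_atTop (b + (-i).toNat)] with N hN
    lia
  have hom : ∀ (i : ℤ) (N : ℕ), Measurable fun z : (ℤ → Bool) × S =>
      o (z.1 i) (drivenState g z.1 (i - -(N : ℤ)).toNat (-N) z.2) := fun i N =>
    (measurable_uncurry_of_bool ho).comp
      (((measurable_pi_apply i).comp measurable_fst).prodMk
        (measurable_drivenState hg measurable_fst measurable_snd _ _))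
  have hEeq : ∀ N : ℕ, (∀ i ∈ F, -(N : ℤ) ≤ i) →
      ∫⁻ x, ∫⁻ s, ∑ i ∈ F, boolDist (φ fun k => x (k + i))
        (o (x i) (drivenState g x (i - -(N : ℤ)).toNat (-N) s)) ∂ρ ∂μ = E N := by
    intro N hN
    have hm : ∀ i, Measurable fun z : (ℤ → Bool) × S => boolDist (φ fun k => z.1 (k + i))
        (o (z.1 i) (drivenState g z.1 (i - -(N : ℤ)).toNat (-N) z.2)) := fun i =>
      ((hshift i).comp measurable_fst).boolDist (hom i N)
    simp only [fun x => lintegral_finsetSum' F (μ := ρ) (f := fun i s =>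
      boolDist (φ fun k => x (k + i)) (o (x i) (drivenState g x (i - -(N : ℤ)).toNat (-N) s)))
      fun i _ => ((hm i).comp measurable_prodMk_left).aemeasurable]
    rw [lintegral_finsetSum F fun i _ => (hm i).lintegral_prod_right']
    refine Finset.sum_congr rfl fun i hi => ?_
    have hM : Measurable fun x : ℤ → Bool => ∫⁻ s, boolDist (φ x)
        (emitted g o (i - -(N : ℤ)).toNat x s) ∂ρ :=
      ((hφ.comp measurable_fst).boolDist
        (measurable_emitted hg ho _ measurable_fst measurable_snd)).lintegral_prod_right'
    rw [← (measurePreserving_shift P i).lintegral_comp hM]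
    refine lintegral_congr fun x => lintegral_congr fun s => ?_
    rw [emitted_shift g o x _ (-N) i (by have := hN i hi; lia)]
  have hev : ∀ᶠ N : ℕ in atTop, ∀ i ∈ F, -(N : ℤ) ≤ i := by
    rw [Filter.eventually_all_finset]
    intro i _
    filter_upwards [eventually_ge_atTop (-i).toNat] with N hN
    lia
  have hsm : ∀ N : ℕ, Measurable fun z : (ℤ → Bool) × S =>
      ∏ i ∈ F, I i (o (z.1 i) (drivenState g z.1 (i - -(N : ℤ)).toNat (-N) z.2)) := fun N =>
    Finset.measurable_fun_prod _ fun i _ => (hI i).comp (hom i N)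
  have hsm' : Measurable fun z : (ℤ → Bool) × S => ∏ i ∈ F, I i (φ fun k => z.1 (k + i)) :=
    Finset.measurable_fun_prod _ fun i _ => (hI i).comp ((hshift i).comp measurable_fst)
  rw [hL]
  refine le_antisymm ?_ ?_
  · refine ge_of_tendsto (x := atTop) (f := fun N => ∏ i ∈ F, P' (u i) + E N) ?_ ?_
    · simpa using hE.const_add (∏ i ∈ F, P' (u i))
    · filter_upwards [hev] with N hN
      rw [← hR N hN, ← hEeq N hN, ← lintegral_add_left (hsm N).lintegral_prod_right']
      refine lintegral_mono fun x => ?_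
      exact (lintegral_mono fun s => prod_indicator_le_add_sum_boolDist F u _ _).trans_eq
        (lintegral_add_left ((hsm N).comp measurable_prodMk_left) _)
  · refine ge_of_tendsto (x := atTop)
      (f := fun N => ∫⁻ x, ∫⁻ _s, ∏ i ∈ F, I i (φ fun k => x (k + i)) ∂ρ ∂μ + E N) ?_ ?_
    · simpa using hE.const_add (∫⁻ x, ∫⁻ _s, ∏ i ∈ F, I i (φ fun k => x (k + i)) ∂ρ ∂μ)
    · filter_upwards [hev] with N hN
      rw [← hR N hN, ← hEeq N hN, ← lintegral_add_left hsm'.lintegral_prod_right']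
      refine lintegral_mono fun x => ?_
      refine (lintegral_mono fun s => ?_).trans_eq
        (lintegral_add_left (hsm'.comp measurable_prodMk_left) _)
      simp only [fun i : ℤ => boolDist_comm (φ fun k => x (k + i))]
      exact prod_indicator_le_add_sum_boolDist F u _ _

end Factor

section Synchronization

open Filter Topology

/-- The expected value of `Φ` after one step of two copies of the system driven by a common
symbol of law `P`. -/
noncomputable def stepAverage {S : Type*} (P : Measure Bool) (g : Bool → S → S)
    (Φ : S × S → ENNReal) (z : S × S) : ENNReal :=
  ∫⁻ c, Φ (g c z.1, g c z.2) ∂P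

lemma measurable_stepAverage {S : Type*} [MeasurableSpace S] {P : Measure Bool} [SFinite P]
    {g : Bool → S → S} (hg : ∀ c, Measurable (g c)) {Φ : S × S → ENNReal} (hΦ : Measurable Φ) :
    Measurable (stepAverage P g Φ) := by
  refine Measurable.lintegral_prod_left' (f := fun w : Bool × (S × S) =>
    Φ (g w.1 w.2.1, g w.1 w.2.2)) ?_
  exact measurable_uncurry_of_bool (f := fun c (w : S × S) => Φ (g c w.1, g c w.2)) fun c =>
    hΦ.comp (((hg c).comp measurable_fst).prodMk ((hg c).comp measurable_snd))

lemma measurable_iterate_stepAverage {S : Type*} [MeasurableSpace S] {P : Measure Bool}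
    [SFinite P] {g : Bool → S → S} (hg : ∀ c, Measurable (g c)) {Φ : S × S → ENNReal}
    (hΦ : Measurable Φ) (n : ℕ) : Measurable ((stepAverage P g)^[n] Φ) := by
  induction n with
  | zero => exact hΦ
  | succ n ih =>
    rw [Function.iterate_succ_apply']
    exact measurable_stepAverage hg ih

lemma lintegral_drivenState_pair {S : Type*} [MeasurableSpace S] {P : Measure Bool}
    [IsProbabilityMeasure P] {g : Bool → S → S} (hg : ∀ c, Measurable (g c))
    {Φ : S × S → ENNReal} (hΦ : Measurable Φ) (n : ℕ) (t : ℤ) (s s' : S) :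
    ∫⁻ x, Φ (drivenState g x n t s, drivenState g x n t s') ∂Measure.infinitePi (fun _ : ℤ => P) =
      (stepAverage P g)^[n] Φ (s, s') := by
  induction n generalizing t s s' with
  | zero => simp [drivenState]
  | succ n ih =>
    rw [lintegral_infinitePi_update P t, Function.iterate_succ_apply']
    · simp only [drivenState, Function.update_self, drivenState_update g _ (lt_add_one t), ih]
      rfl
    · exact hΦ.comp ((measurable_drivenState hg measurable_id measurable_const _ _).prodMk
        (measurable_drivenState hg measurable_id measurable_const _ _))

/-- The expected value of `Φ` at the states reached after `n` steps by two copies of the driven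
system started independently from `ρ`. -/
noncomputable def pairAverage {S : Type*} [MeasurableSpace S] (P : Measure Bool) (ρ : Measure S)
    (g : Bool → S → S) (n : ℕ) (Φ : S × S → ENNReal) : ENNReal :=
  ∫⁻ z, (stepAverage P g)^[n] Φ z ∂ρ.prod ρ

lemma pairAverage_add {S : Type*} [MeasurableSpace S] (P : Measure Bool) (ρ : Measure S)
    (g : Bool → S → S) (n m : ℕ) (Φ : S × S → ENNReal) :
    pairAverage P ρ g (n + m) Φ = pairAverage P ρ g n ((stepAverage P g)^[m] Φ) := by
  rw [pairAverage, Function.iterate_add_apply]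
  rfl

section PairAverage

variable {S : Type*} [MeasurableSpace S] {P : Measure Bool} {ρ : Measure S} {g : Bool → S → S}

lemma pairAverage_mono {Φ Ψ : S × S → ENNReal} (h : ∀ z, Φ z ≤ Ψ z) (n : ℕ) :
    pairAverage P ρ g n Φ ≤ pairAverage P ρ g n Ψ := by
  refine lintegral_mono ?_
  suffices ∀ z, (stepAverage P g)^[n] Φ z ≤ (stepAverage P g)^[n] Ψ z from this
  induction n with
  | zero => exact h
  | succ n ih =>
    intro z
    simp only [Function.iterate_succ_apply']
    exact lintegral_mono fun c => ih _

variable [IsProbabilityMeasure P]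

lemma pairAverage_eq (hg : ∀ c, Measurable (g c)) {Φ : S × S → ENNReal} (hΦ : Measurable Φ)
    (n : ℕ) (t : ℤ) : pairAverage P ρ g n Φ =
      ∫⁻ z, ∫⁻ x, Φ (drivenState g x n t z.1, drivenState g x n t z.2)
        ∂Measure.infinitePi (fun _ : ℤ => P) ∂ρ.prod ρ := by
  simp only [lintegral_drivenState_pair hg hΦ]
  rfl

lemma measurable_drivenState_pair (hg : ∀ c, Measurable (g c)) {Φ : S × S → ENNReal}
    (hΦ : Measurable Φ) (n : ℕ) (t : ℤ) : Measurable fun w : (S × S) × (ℤ → Bool) =>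
      Φ (drivenState g w.2 n t w.1.1, drivenState g w.2 n t w.1.2) :=
  hΦ.comp ((measurable_drivenState hg measurable_snd (measurable_fst.comp measurable_fst) _
    _).prodMk
    (measurable_drivenState hg measurable_snd (measurable_snd.comp measurable_fst) _ _))

lemma pairAverage_fun_add (hg : ∀ c, Measurable (g c)) {Φ Ψ : S × S → ENNReal}
    (hΦ : Measurable Φ) (hΨ : Measurable Ψ) (n : ℕ) :
    pairAverage P ρ g n (fun z => Φ z + Ψ z) = pairAverage P ρ g n Φ + pairAverage P ρ g n Ψ := by
  rw [pairAverage_eq (Φ := fun z => Φ z + Ψ z) hg (hΦ.add hΨ) n 0, pairAverage_eq hg hΦ n 0,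
    pairAverage_eq hg hΨ n 0,
    ← lintegral_add_left (measurable_drivenState_pair hg hΦ n 0).lintegral_prod_right']
  refine lintegral_congr fun z => ?_
  exact lintegral_add_left ((measurable_drivenState_pair hg hΦ n 0).comp measurable_prodMk_left) _

lemma pairAverage_const_mul (hg : ∀ c, Measurable (g c)) {Φ : S × S → ENNReal}
    (hΦ : Measurable Φ) (r : ENNReal) (n : ℕ) :
    pairAverage P ρ g n (fun z => r * Φ z) = r * pairAverage P ρ g n Φ := by
  rw [pairAverage_eq hg (hΦ.const_mul r) n 0, pairAverage_eq hg hΦ n 0,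
    ← lintegral_const_mul _ (measurable_drivenState_pair hg hΦ n 0).lintegral_prod_right']
  refine lintegral_congr fun z => ?_
  exact lintegral_const_mul _ ((measurable_drivenState_pair hg hΦ n 0).comp measurable_prodMk_left)

variable [IsProbabilityMeasure ρ] {P' : Measure Bool} [IsProbabilityMeasure P']
    {o : Bool → S → Bool}

lemma lintegral_lintegral_drivenState (hg : ∀ c, Measurable (g c)) (ho : ∀ c, Measurable (o c))
    (H : (P.prod ρ).map (fun z => (o z.1 z.2, g z.1 z.2)) = P'.prod ρ) {φ : S → ENNReal}
    (hφ : Measurable φ) (n : ℕ) :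
    ∫⁻ s, ∫⁻ x, φ (drivenState g x n 0 s) ∂Measure.infinitePi (fun _ : ℤ => P) ∂ρ =
      ∫⁻ s, φ s ∂ρ := by
  rw [lintegral_lintegral_swap, lintegral_drivenState hg ho H (Φ := fun _ s => φ s)
    (hφ.comp measurable_snd) n 0 fun _ _ _ _ => rfl]
  · simp
  · exact (hφ.comp (measurable_drivenState hg measurable_snd measurable_fst _ _)).aemeasurable

lemma pairAverage_fst (hg : ∀ c, Measurable (g c)) (ho : ∀ c, Measurable (o c))
    (H : (P.prod ρ).map (fun z => (o z.1 z.2, g z.1 z.2)) = P'.prod ρ) {φ : S → ENNReal}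
    (hφ : Measurable φ) (n : ℕ) :
    pairAverage P ρ g n (fun z => φ z.1) = ∫⁻ s, φ s ∂ρ := by
  rw [pairAverage_eq (Φ := fun z => φ z.1) hg (hφ.comp measurable_fst) n 0, lintegral_prod _
    (Measurable.aemeasurable
    (measurable_drivenState_pair (Φ := fun z => φ z.1) hg (hφ.comp measurable_fst) n
      0).lintegral_prod_right'),
    ← lintegral_lintegral_drivenState hg ho H hφ n]
  simp

lemma pairAverage_snd (hg : ∀ c, Measurable (g c)) (ho : ∀ c, Measurable (o c))
    (H : (P.prod ρ).map (fun z => (o z.1 z.2, g z.1 z.2)) = P'.prod ρ) {φ : S → ENNReal}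
    (hφ : Measurable φ) (n : ℕ) :
    pairAverage P ρ g n (fun z => φ z.2) = ∫⁻ s, φ s ∂ρ := by
  rw [pairAverage_eq (Φ := fun z => φ z.2) hg (hφ.comp measurable_snd) n 0, lintegral_prod _
    (Measurable.aemeasurable
    (measurable_drivenState_pair (Φ := fun z => φ z.2) hg (hφ.comp measurable_snd) n
      0).lintegral_prod_right'),
    ← lintegral_lintegral_drivenState hg ho H hφ n]
  simp

end PairAverage

lemma tendsto_zero_of_add_mul_le {a w : ℕ → ENNReal} {c : ENNReal} (m : ℕ) (ha : Antitone a)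
    (ha0 : a 0 ≠ ⊤) (hc : c ≠ 0) (hc' : c ≠ ⊤) (h : ∀ n, a (n + m) + c * w n ≤ a n) :
    Tendsto w atTop (𝓝 0) := by
  have hfin : ∀ n, a n ≠ ⊤ := fun n => ne_top_of_le_ne_top ha0 (ha n.zero_le)
  have hl : Tendsto a atTop (𝓝 (⨅ n, a n)) := tendsto_atTop_iInf ha
  have hl' : (⨅ n, a n) ≠ ⊤ := ne_top_of_le_ne_top ha0 (iInf_le _ 0)
  have hsub : Tendsto (fun n => (a n - a (n + m)) / c) atTop (𝓝 0) := by
    have := ENNReal.Tendsto.div_const (ENNReal.Tendsto.sub hl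
      (hl.comp (tendsto_add_atTop_nat m)) (Or.inl hl')) (b := c) (Or.inr hc)
    simpa using this
  refine tendsto_of_tendsto_of_tendsto_of_le_of_le tendsto_const_nhds hsub (fun _ => zero_le)
    fun n => ?_
  rw [ENNReal.le_div_iff_mul_le (Or.inl hc) (Or.inl hc'), mul_comm]
  exact ENNReal.le_sub_of_add_le_left (hfin _) (h n)

lemma abs_iterate_sub_lt {f : ℝ → ℝ} {b : ℝ} (hf : ∀ s s', |f s - f s'| ≤ |s - s'|)
    (hfb : ∀ s, b ≤ s → f s = s - b)
    (hstrict : ∀ s s', s ≠ s' → s < b → |f s - f s'| < |s - s'|) (m : ℕ) {s s' : ℝ}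
    (hne : s ≠ s') (h : s < b * (m + 1)) : |f^[m + 1] s - f^[m + 1] s'| < |s - s'| := by
  have hiter : ∀ n s s', |f^[n] s - f^[n] s'| ≤ |s - s'| := by
    intro n
    induction n with
    | zero => simp
    | succ n ih => exact fun s s' => (ih _ _).trans (hf s s')
  induction m generalizing s s' with
  | zero => exact hstrict s s' hne (by simpa using h)
  | succ m ih =>
    rw [Function.iterate_succ_apply f (m + 1) s, Function.iterate_succ_apply f (m + 1) s']
    by_cases h1 : s < b
    · exact (hiter _ _ _).trans_lt (hstrict s s' hne h1)
    by_cases h2 : s' < b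
    · refine (hiter _ _ _).trans_lt ?_
      rw [abs_sub_comm, abs_sub_comm s]
      exact hstrict s' s hne.symm h2
    · rw [hfb s (not_lt.mp h1), hfb s' (not_lt.mp h2)]
      refine (ih (fun e => hne (by linarith)) (by push_cast at h; linarith)).trans_eq ?_
      congr 1
      ring

/-- The output `false` is emitted exactly when the input is `false` and the state is at
least `θ`. -/
noncomputable def thresholdOutput (θ : ℝ) (c : Bool) (s : ℝ) : Bool := c || decide (s < θ)

lemma measurable_thresholdOutput (θ : ℝ) (c : Bool) : Measurable (thresholdOutput θ c) := by
  refine measurable_to_bool ?_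
  cases c
  · convert! (measurableSet_Iio : MeasurableSet (Set.Iio θ)) using 1
    ext s
    simp [thresholdOutput]
  · convert! MeasurableSet.univ using 1
    ext s
    simp [thresholdOutput]

theorem tendsto_emitted_dist {P P' : Measure Bool} [IsProbabilityMeasure P]
    [IsProbabilityMeasure P'] {ρ : Measure ℝ} [IsProbabilityMeasure ρ] {g : Bool → ℝ → ℝ}
    {θ b : ℝ} (hg : ∀ c s s', |g c s - g c s'| ≤ |s - s'|) (hb : 0 < b)
    (hgb : ∀ s, b ≤ s → g false s = s - b)
    (hstrict : ∀ s s', s ≠ s' → s < b → |g false s - g false s'| < |s - s'|)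
    (hP : P {false} ≠ 0) (hθ : ρ {θ} = 0)
    (H : (P.prod ρ).map (fun z => (thresholdOutput θ z.1 z.2, g z.1 z.2)) = P'.prod ρ) :
    Tendsto (fun n : ℕ => ∫⁻ s, ∫⁻ s', ∫⁻ x, boolDist (emitted g (thresholdOutput θ) n x s)
      (emitted g (thresholdOutput θ) n x s') ∂Measure.infinitePi (fun _ : ℤ => P) ∂ρ ∂ρ)
      atTop (𝓝 0) := by
  set μ := Measure.infinitePi (fun _ : ℤ => P) with hμ
  have hcont : ∀ c, Continuous (g c) := fun c =>
    (LipschitzWith.of_dist_le_mul (K := 1) fun s s' => by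
      simpa [Real.dist_eq] using hg c s s').continuous
  have hgm : ∀ c, Measurable (g c) := fun c => (hcont c).measurable
  have hom : ∀ c, Measurable (thresholdOutput θ c) := measurable_thresholdOutput θ
  let W := pairAverage P ρ g
  let M : ℝ × ℝ → ENNReal := fun z =>
    boolDist (thresholdOutput θ false z.1) (thresholdOutput θ false z.2)
  have hM : Measurable M := ((hom _).comp measurable_fst).boolDist ((hom _).comp measurable_snd)
  have hbound : ∀ n, ∫⁻ s, ∫⁻ s', ∫⁻ x, boolDist (emitted g (thresholdOutput θ) n x s)
      (emitted g (thresholdOutput θ) n x s') ∂μ ∂ρ ∂ρ ≤ W n M := by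
    intro n
    rw [show W n M = _ from pairAverage_eq hgm hM n (-n), lintegral_prod _
      (measurable_drivenState_pair hgm hM n (-n)).lintegral_prod_right'.aemeasurable]
    gcongr with s s' x
    unfold emitted
    cases x 0
    · exact le_rfl
    · simp [thresholdOutput, boolDist]
  let L : ℝ × ℝ → ENNReal := fun z => ENNReal.ofReal (Real.arctan |z.1 - z.2|)
  have hL : Measurable L := by fun_prop
  have hdriven : ∀ x n t s s', |drivenState g x n t s - drivenState g x n t s'| ≤ |s - s'| := by
    intro x n
    induction n with
    | zero => simp [drivenState]
    | succ n ih => exact fun t s s' => (ih _ _ _).trans (hg _ s s')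
  have hU : ∀ K ε : ℝ, 0 < ε → Tendsto (fun n => W n (Set.indicator
      {z : ℝ × ℝ | (|z.1| ≤ K ∧ |z.2| ≤ K) ∧ ε ≤ |z.1 - z.2|} 1)) atTop (𝓝 0) := by
    intro K ε hε
    set U := {z : ℝ × ℝ | (|z.1| ≤ K ∧ |z.2| ≤ K) ∧ ε ≤ |z.1 - z.2|} with hUdef
    have hUcl : IsClosed {z : ℝ × ℝ | ε ≤ |z.1 - z.2|} :=
      isClosed_le continuous_const (by fun_prop)
    have hUc : IsCompact U := by
      have : U = (Set.Icc (-K) K ×ˢ Set.Icc (-K) K) ∩ {z : ℝ × ℝ | ε ≤ |z.1 - z.2|} := by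
        ext z
        simp only [hUdef, abs_le, Set.mem_ofPred_eq, Set.mem_inter_iff, Set.mem_prod, Set.mem_Icc]
      rw [this]
      exact (isCompact_Icc.prod isCompact_Icc).inter_right hUcl
    have hUm : MeasurableSet U := hUc.measurableSet
    obtain ⟨m, hm⟩ := exists_nat_gt (K / b)
    have hmK : K < b * (m + 1) := by
      rw [div_lt_iff₀ hb] at hm
      nlinarith
    obtain ⟨η, hη, hηU⟩ := hUc.exists_forall_le' (f := fun z : ℝ × ℝ => Real.arctan |z.1 - z.2| -
      Real.arctan |(g false)^[m + 1] z.1 - (g false)^[m + 1] z.2|) (a := 0)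
      (by
        have := (hcont false).iterate (m + 1)
        fun_prop)
      (by
        rintro z ⟨⟨h1, -⟩, h3⟩
        refine sub_pos.mpr (Real.arctan_strictMono ?_)
        refine abs_iterate_sub_lt (hg false) hgb hstrict m ?_
          ((le_abs_self _).trans_lt (h1.trans_lt hmK))
        intro h
        rw [h] at h3
        simp at h3
        linarith)
    let E : Set (ℤ → Bool) := ((Finset.Ico (0 : ℤ) ((m + 1 : ℕ) : ℤ) : Finset ℤ) : Set ℤ).pi
      fun _ => {false}
    have hEm : MeasurableSet E := .pi (Finset.countable_toSet _) fun _ _ => .singleton _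
    have hE : μ E ≠ 0 := by
      rw [hμ, Measure.infinitePi_pi _ fun _ _ => .singleton _]
      simp [hP]
    have hEdriven : ∀ x (n : ℕ) (t : ℤ) s, (∀ k, t ≤ k → k < t + n → x k = false) →
        drivenState g x n t s = (g false)^[n] s := by
      intro x n
      induction n with
      | zero => exact fun _ _ _ => rfl
      | succ n ih =>
        intro t s h
        rw [Function.iterate_succ_apply]
        simp only [drivenState]
        rw [h t le_rfl (by push_cast; lia), ih]
        exact fun k hk hk' => h k (by lia) (by push_cast; lia)
    have hstep : ∀ z, (stepAverage P g)^[m + 1] L z +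
        ENNReal.ofReal η * μ E * U.indicator 1 z ≤ L z := by
      intro z
      rw [← lintegral_drivenState_pair hgm hL (m + 1) 0]
      have : ENNReal.ofReal η * μ E * U.indicator 1 z =
          ∫⁻ x, E.indicator (fun _ => ENNReal.ofReal η * U.indicator 1 z) x ∂μ := by
        rw [lintegral_indicator_const hEm]
        ring
      rw [this, ← lintegral_add_right _ (measurable_const.indicator hEm)]
      calc _ ≤ ∫⁻ _x, L z ∂μ := lintegral_mono fun x => ?_
        _ = L z := by simp
      by_cases hx : x ∈ E ∧ z ∈ U
      · have hd : ∀ s, drivenState g x (m + 1) 0 s = (g false)^[m + 1] s := fun s =>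
          hEdriven x (m + 1) 0 s fun k hk hk' => hx.1 k (by simp at hk' ⊢; lia)
        simp only [Set.indicator_of_mem hx.1, Set.indicator_of_mem hx.2, hd, L, Pi.one_apply,
          mul_one]
        rw [← ENNReal.ofReal_add (by positivity) hη.le]
        refine ENNReal.ofReal_le_ofReal ?_
        linarith [hηU z hx.2]
      · have : E.indicator (fun _ => ENNReal.ofReal η * U.indicator 1 z) x = 0 := by
          by_cases h : x ∈ E
          · simp [show z ∉ U from fun h' => hx ⟨h, h'⟩]
          · simp [h]
        rw [this, add_zero]
        exact ENNReal.ofReal_le_ofReal (Real.arctan_strictMono.monotone (hdriven _ _ _ _ _))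
    refine tendsto_zero_of_add_mul_le (a := fun n => W n L) (c := ENNReal.ofReal η * μ E)
      (m + 1) (antitone_nat_of_succ_le fun n => ?_) ?_ ?_ ?_ fun n => ?_
    · change pairAverage P ρ g (n + 1) L ≤ _
      rw [pairAverage_add]
      refine pairAverage_mono (fun z => ?_) n
      calc _ ≤ ∫⁻ _c, L z ∂P := lintegral_mono fun c =>
            ENNReal.ofReal_le_ofReal (Real.arctan_strictMono.monotone (hg c _ _))
        _ = L z := by rw [lintegral_const, measure_univ, mul_one]
    · have : W 0 L ≤ ENNReal.ofReal (Real.pi / 2) := by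
        calc W 0 L ≤ ∫⁻ _z, ENNReal.ofReal (Real.pi / 2) ∂ρ.prod ρ :=
              lintegral_mono fun z => ENNReal.ofReal_le_ofReal (Real.arctan_lt_pi_div_two _).le
          _ = _ := by simp
      exact ne_top_of_le_ne_top ENNReal.ofReal_ne_top this
    · simp [hη, hE]
    · exact ENNReal.mul_ne_top ENNReal.ofReal_ne_top (measure_ne_top μ E)
    · have hUi : Measurable (U.indicator (1 : ℝ × ℝ → ENNReal)) := measurable_one.indicator hUm
      change pairAverage P ρ g (n + (m + 1)) L + _ * pairAverage P ρ g n _ ≤ _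
      rw [pairAverage_add, ← pairAverage_const_mul hgm hUi,
        ← pairAverage_fun_add hgm (measurable_iterate_stepAverage hgm hL _) (hUi.const_mul _)]
      exact pairAverage_mono hstep n
  have htail : ∀ e : ENNReal, 0 < e → ∃ K : ℝ, ρ {s | K < |s|} ≤ e := by
    intro e he
    have := tendsto_measure_iInter_atTop (μ := ρ) (s := fun n : ℕ => {s : ℝ | (n : ℝ) < |s|})
      (fun n => (measurableSet_lt measurable_const (by fun_prop)).nullMeasurableSet)
      (fun n n' h s (hs : (n' : ℝ) < |s|) => lt_of_le_of_lt (Nat.cast_le.mpr h) hs)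
      ⟨0, measure_ne_top _ _⟩
    have h0 : ⋂ n : ℕ, {s : ℝ | (n : ℝ) < |s|} = ∅ := by
      refine Set.eq_empty_of_forall_notMem fun s hs => ?_
      obtain ⟨n, hn⟩ := exists_nat_ge |s|
      exact absurd (Set.mem_iInter.mp hs n) (not_lt.mpr hn)
    rw [h0, measure_empty] at this
    obtain ⟨n, hn⟩ := (this.eventually (ge_mem_nhds he)).exists
    exact ⟨n, hn⟩
  have hball : ∀ e : ENNReal, 0 < e → ∃ ε > 0, ρ {s | |s - θ| < ε} ≤ e := by
    intro e he
    have := tendsto_measure_cthickening_of_isClosed (μ := ρ) (s := {θ})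
      ⟨1, one_pos, measure_ne_top _ _⟩ isClosed_singleton
    rw [hθ] at this
    obtain ⟨ε, hε, hε0⟩ := ((this.mono_left nhdsWithin_le_nhds).eventually (ge_mem_nhds he)
      |>.and (self_mem_nhdsWithin (a := (0 : ℝ)) (s := Set.Ioi 0))).exists
    refine ⟨ε, hε0, (measure_mono fun s hs => ?_).trans hε⟩
    rw [Metric.cthickening_singleton _ (le_of_lt hε0), Metric.mem_closedBall, Real.dist_eq]
    exact le_of_lt hs
  rw [ENNReal.tendsto_nhds_zero]
  intro e he
  have he4 : 0 < e / 2 / 2 := ENNReal.div_pos (ENNReal.div_pos he.ne' (by simp)).ne' (by simp)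
  obtain ⟨K, hK⟩ := htail _ he4
  obtain ⟨ε, hε, hεθ⟩ := hball _ he4
  filter_upwards [(hU K ε hε).eventually (ge_mem_nhds he4)] with n hn
  refine (hbound n).trans ?_
  have hm1 : MeasurableSet {s : ℝ | K < |s|} := measurableSet_lt measurable_const (by fun_prop)
  have hm2 : MeasurableSet {s : ℝ | |s - θ| < ε} := measurableSet_lt (by fun_prop) measurable_const
  have hm3 : MeasurableSet {z : ℝ × ℝ | (|z.1| ≤ K ∧ |z.2| ≤ K) ∧ ε ≤ |z.1 - z.2|} := by
    measurability
  set I1 : ℝ → ENNReal := Set.indicator {s : ℝ | K < |s|} 1 with hI1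
  set I2 : ℝ → ENNReal := Set.indicator {s : ℝ | |s - θ| < ε} 1 with hI2
  set I3 : ℝ × ℝ → ENNReal :=
    Set.indicator {z : ℝ × ℝ | (|z.1| ≤ K ∧ |z.2| ≤ K) ∧ ε ≤ |z.1 - z.2|} 1 with hI3
  have hI1m : Measurable I1 := measurable_one.indicator hm1
  have hI2m : Measurable I2 := measurable_one.indicator hm2
  have hI3m : Measurable I3 := measurable_one.indicator hm3
  calc W n M ≤ W n (fun z => I3 z + (I1 z.1 + (I1 z.2 + I2 z.1))) := by
        refine pairAverage_mono (fun z => ?_) n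
        by_cases h : thresholdOutput θ false z.1 = thresholdOutput θ false z.2
        · simp [M, boolDist, h]
        refine (boolDist_le_one _ _).trans ?_
        by_cases h1 : K < |z.1|
        · calc (1 : ENNReal) = I1 z.1 := by simp [hI1, h1]
            _ ≤ _ := le_add_self.trans' le_self_add
        by_cases h2 : K < |z.2|
        · calc (1 : ENNReal) = I1 z.2 := by simp [hI1, h2]
            _ ≤ _ := le_add_self.trans' (le_add_self.trans' le_self_add)
        by_cases h3 : ε ≤ |z.1 - z.2|
        · calc (1 : ENNReal) = I3 z := by simp [hI3, h3, not_lt.mp h1, not_lt.mp h2]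
            _ ≤ _ := le_self_add
        · have h4 : |z.1 - θ| < ε := by
            refine lt_of_le_of_lt ?_ (not_le.mp h3)
            have hne : ¬(z.1 < θ ↔ z.2 < θ) := by simpa [thresholdOutput] using h
            by_cases hz : z.1 < θ
            · have : θ ≤ z.2 := by
                by_contra! h'
                exact hne (iff_of_true hz h')
              rw [abs_of_neg (by linarith), abs_of_neg (by linarith)]
              linarith
            · have : z.2 < θ := by
                by_contra! h'
                exact hne (iff_of_false hz (not_lt.mpr h'))
              rw [abs_of_nonneg (by linarith), abs_of_pos (by linarith)]
              linarith
          calc (1 : ENNReal) = I2 z.1 := by simp [hI2, h4]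
            _ ≤ _ := le_add_self.trans' (le_add_self.trans' le_add_self)
    _ = W n I3 + (ρ {s | K < |s|} + (ρ {s | K < |s|} + ρ {s | |s - θ| < ε})) := by
        have hf1 : Measurable fun z : ℝ × ℝ => I1 z.1 := hI1m.comp measurable_fst
        have hf2 : Measurable fun z : ℝ × ℝ => I1 z.2 := hI1m.comp measurable_snd
        have hf3 : Measurable fun z : ℝ × ℝ => I2 z.1 := hI2m.comp measurable_fst
        have hf23 : Measurable fun z : ℝ × ℝ => I1 z.2 + I2 z.1 := hf2.add hf3
        have hf123 : Measurable fun z : ℝ × ℝ => I1 z.1 + (I1 z.2 + I2 z.1) := hf1.add hf23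
        change pairAverage P ρ g n _ = pairAverage P ρ g n _ + _
        rw [pairAverage_fun_add hgm hI3m hf123, pairAverage_fun_add hgm hf1 hf23,
          pairAverage_fun_add hgm hf2 hf3]
        have e1 := pairAverage_fst hgm hom H hI1m n
        have e2 := pairAverage_snd hgm hom H hI1m n
        have e3 := pairAverage_fst hgm hom H hI2m n
        rw [lintegral_indicator_one hm1] at e1 e2
        rw [lintegral_indicator_one hm2] at e3
        rw [e1, e2, e3]
    _ ≤ e / 2 / 2 + (e / 2 / 2 + (e / 2 / 2 + e / 2 / 2)) := by gcongr
    _ = e := by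
        rw [← add_assoc, ENNReal.add_halves, ENNReal.add_halves]

end Synchronization

lemma isProbabilityMeasure_bernoulliMeasure {r : ℝ} (h0 : 0 ≤ r) (h1 : r ≤ 1) :
    IsProbabilityMeasure (_root_.bernoulliMeasure r) := by
  refine ⟨?_⟩
  simp only [_root_.bernoulliMeasure, Measure.add_apply, Measure.smul_apply, measure_univ,
    smul_eq_mul,
    mul_one]
  rw [← ENNReal.ofReal_add h0 (sub_nonneg.mpr h1)]
  simp

lemma bernoulliMeasure_eq_indicator (r : ℝ) (s : Set Bool) :
    _root_.bernoulliMeasure r s = ENNReal.ofReal r * s.indicator 1 true +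
      ENNReal.ofReal (1 - r) * s.indicator 1 false := by
  simp [_root_.bernoulliMeasure]

lemma lintegral_bernoulliMeasure (r : ℝ) (f : Bool → ENNReal) :
    ∫⁻ c, f c ∂_root_.bernoulliMeasure r = ENNReal.ofReal r * f true + ENNReal.ofReal (1 - r) * f
      false := by
  simp [_root_.bernoulliMeasure, lintegral_add_measure]

/-- There is a measurable `φ`, dominating the coordinate at `0`, whose translates form an i.i.d.
Bernoulli(`p'`) family when applied to an i.i.d. Bernoulli(`p`) sequence indexed by `ℤ`. -/
def HasIntThickening (p p' : ℝ) : Prop :=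
  ∃ φ : (ℤ → Bool) → Bool, Measurable φ ∧ (∀ x, x 0 ≤ φ x) ∧
    (Measure.infinitePi fun _ : ℤ => _root_.bernoulliMeasure p).map
      (fun x i => φ fun k => x (k + i)) =
      Measure.infinitePi fun _ : ℤ => _root_.bernoulliMeasure p'

theorem hasIntThickening_of_system {p p' : ℝ} (hp : 0 ≤ p) (hp1 : p < 1) (hp' : 0 ≤ p')
    (hp1' : p' ≤ 1) {ρ : Measure ℝ} [IsProbabilityMeasure ρ] {g : Bool → ℝ → ℝ}
    {θ b : ℝ} (hg : ∀ c s s', |g c s - g c s'| ≤ |s - s'|) (hb : 0 < b)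
    (hgb : ∀ s, b ≤ s → g false s = s - b)
    (hstrict : ∀ s s', s ≠ s' → s < b → |g false s - g false s'| < |s - s'|) (hθ : ρ {θ} = 0)
    (hfalse : ∀ B, MeasurableSet B → ENNReal.ofReal (1 - p) * ρ (g false ⁻¹' B ∩ Set.Ici θ) =
      ENNReal.ofReal (1 - p') * ρ B)
    (htrue : ∀ B, MeasurableSet B → ENNReal.ofReal p * ρ (g true ⁻¹' B) +
      ENNReal.ofReal (1 - p) * ρ (g false ⁻¹' B ∩ Set.Iio θ) = ENNReal.ofReal p' * ρ B) :
    HasIntThickening p p' := by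
  have := isProbabilityMeasure_bernoulliMeasure hp hp1.le
  have := isProbabilityMeasure_bernoulliMeasure hp' hp1'
  have hgm : ∀ c, Measurable (g c) := fun c =>
    (LipschitzWith.of_dist_le_mul (K := 1) fun s s' => by
      simpa [Real.dist_eq] using hg c s s').continuous.measurable
  have hm : Measurable fun z : Bool × ℝ => (thresholdOutput θ z.1 z.2, g z.1 z.2) :=
    (measurable_uncurry_of_bool (measurable_thresholdOutput θ)).prodMk
      (measurable_uncurry_of_bool hgm)
  have H : ((_root_.bernoulliMeasure p).prod ρ).map
      (fun z => (thresholdOutput θ z.1 z.2, g z.1 z.2)) = (_root_.bernoulliMeasure p').prod ρ := by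
    refine (Measure.prod_eq fun s B hs hB => ?_).symm
    rw [Measure.map_apply hm (hs.prod hB), Measure.prod_apply (hm (hs.prod hB)),
      lintegral_bernoulliMeasure, bernoulliMeasure_eq_indicator, add_mul, mul_right_comm, ← htrue B
        hB,
      mul_right_comm, ← hfalse B hB]
    have h1 : ρ (Prod.mk true ⁻¹' ((fun z : Bool × ℝ =>
        (thresholdOutput θ z.1 z.2, g z.1 z.2)) ⁻¹' s ×ˢ B)) =
          s.indicator 1 true * ρ (g true ⁻¹' B) := by
      by_cases h : true ∈ s
      · simp only [Set.indicator_of_mem h, Pi.one_apply, one_mul]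
        congr 1
        ext x
        simp [thresholdOutput, h]
      · simp only [Set.indicator_of_notMem h, zero_mul]
        convert! measure_empty (μ := ρ)
        ext x
        simp [thresholdOutput, h]
    have h2 : ρ (Prod.mk false ⁻¹' ((fun z : Bool × ℝ =>
        (thresholdOutput θ z.1 z.2, g z.1 z.2)) ⁻¹' s ×ˢ B)) =
          s.indicator 1 true * ρ (g false ⁻¹' B ∩ Set.Iio θ) +
            s.indicator 1 false * ρ (g false ⁻¹' B ∩ Set.Ici θ) := by
      rw [← measure_inter_add_sdiff _ (measurableSet_Iio (a := θ))]
      congr 1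
      · by_cases h : true ∈ s
        · simp only [Set.indicator_of_mem h, Pi.one_apply, one_mul]
          congr 1
          ext x
          by_cases hx : x < θ <;> simp [thresholdOutput, h, hx]
        · simp only [Set.indicator_of_notMem h, zero_mul]
          convert! measure_empty (μ := ρ)
          ext x
          by_cases hx : x < θ <;> simp [thresholdOutput, h, hx]
      · by_cases h : false ∈ s
        · simp only [Set.indicator_of_mem h, Pi.one_apply, one_mul]
          congr 1
          ext x
          rcases lt_or_ge x θ with hx | hx
          · simp [thresholdOutput, hx]
          · simp [thresholdOutput, h, hx, hx.not_gt]
        · simp only [Set.indicator_of_notMem h, zero_mul]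
          convert! measure_empty (μ := ρ)
          ext x
          by_cases hx : x < θ <;> simp [thresholdOutput, h, hx]
    rw [h1, h2]
    ring
  refine exists_equivariant_factor hgm (measurable_thresholdOutput θ) H
    (tendsto_emitted_dist hg hb hgb hstrict ?_ hθ H) fun s => by simp [thresholdOutput]
  simp [bernoulliMeasure_eq_indicator, hp1]

/-- The stationary law of the box-ball carrier. -/
noncomputable def geometricReal (θ : ℝ) : Measure ℝ :=
  Measure.sum fun k : ℕ => ENNReal.ofReal ((1 - θ) * θ ^ k) • Measure.dirac (k : ℝ)

lemma geometricReal_apply (θ : ℝ) (B : Set ℝ) : geometricReal θ B =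
    ∑' k : ℕ, ENNReal.ofReal ((1 - θ) * θ ^ k) * B.indicator 1 (k : ℝ) := by
  rw [geometricReal, Measure.sum_apply_of_countable]
  simp [Measure.dirac_apply]

theorem hasIntThickening_one_sub {p : ℝ} (hp : 0 < p) (hp2 : p < 1 / 2) :
    HasIntThickening p (1 - p) := by
  set θ : ℝ := p / (1 - p) with hθ
  have hq : 0 < 1 - p := by linarith
  have hθ0 : 0 ≤ θ := by positivity
  have hθ1 : θ < 1 := by rw [hθ, div_lt_one hq]; linarith
  have hθp : (1 - p) * θ = p := by rw [hθ]; field_simp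
  have : IsProbabilityMeasure (geometricReal θ) := by
    refine ⟨?_⟩
    simp only [geometricReal_apply, Set.indicator_univ, Pi.one_apply, mul_one]
    rw [← ENNReal.ofReal_tsum_of_nonneg (fun k => mul_nonneg (by linarith) (pow_nonneg hθ0 k))
      ((summable_geometric_of_lt_one hθ0 hθ1).mul_left _), tsum_mul_left,
      tsum_geometric_of_lt_one hθ0 hθ1, mul_inv_cancel₀ (by linarith), ENNReal.ofReal_one]
  let g : Bool → ℝ → ℝ := fun c s => bif c then s + 1 else max (s - 1) 0
  have hw : ∀ (k : ℕ) (x : ENNReal), ENNReal.ofReal (1 - p) *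
      (ENNReal.ofReal ((1 - θ) * θ ^ (k + 1)) * x) =
        ENNReal.ofReal p * (ENNReal.ofReal ((1 - θ) * θ ^ k) * x) := by
    intro k x
    rw [← mul_assoc, ← mul_assoc, ← ENNReal.ofReal_mul hq.le, ← ENNReal.ofReal_mul hp.le]
    congr 2
    linear_combination ((1 - θ) * θ ^ k) * hθp
  refine hasIntThickening_of_system (θ := 1 / 2) (b := 1) (ρ := geometricReal θ) (g := g) hp.le
    (by linarith) hq.le (by linarith) ?_ one_pos ?_ ?_ ?_ ?_ ?_
  · rintro (_ | _) s s'
    · calc |max (s - 1) 0 - max (s' - 1) 0| ≤ |(s - 1) - (s' - 1)| := abs_max_sub_max_le_abs _ _ _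
        _ = |s - s'| := by ring_nf
    · exact le_of_eq (by simp [g])
  · exact fun s hs => max_eq_left (by linarith)
  · intro s s' hne h
    simp only [g, cond_false]
    rw [max_eq_right (by linarith : s - 1 ≤ 0)]
    rcases le_total (s' - 1) 0 with h' | h'
    · rw [max_eq_right h']
      simpa using sub_ne_zero.mpr hne
    · rw [max_eq_left h', abs_of_nonpos (by linarith), abs_of_neg (by linarith)]
      linarith
  · rw [geometricReal_apply]
    simp only [ENNReal.tsum_eq_zero, mul_eq_zero]
    refine fun k => Or.inr (Set.indicator_of_notMem ?_ _)
    simp only [Set.mem_singleton_iff]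
    intro h
    have : (2 * k : ℝ) = 1 := by linarith
    norm_cast at this
    lia
  · intro B _
    rw [geometricReal_apply, geometricReal_apply, tsum_eq_zero_add' ENNReal.summable,
      sub_sub_cancel,
      ← ENNReal.tsum_mul_left]
    have h0 : (g false ⁻¹' B ∩ Set.Ici (1 / 2)).indicator (1 : ℝ → ENNReal) ((0 : ℕ) : ℝ) = 0 :=
      Set.indicator_of_notMem (by simp) _
    rw [h0, mul_zero, zero_add, ← ENNReal.tsum_mul_left]
    refine tsum_congr fun k => ?_
    rw [hw]
    congr 2
    by_cases h : (k : ℝ) ∈ B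
    · rw [Set.indicator_of_mem h, Set.indicator_of_mem]
      · rfl
      · refine ⟨by simpa [g] using h, ?_⟩
        have := k.cast_nonneg (α := ℝ)
        simp only [Set.mem_Ici]
        push_cast
        linarith
    · rw [Set.indicator_of_notMem h, Set.indicator_of_notMem]
      exact fun h' => h (by simpa [g] using h'.1)
  · intro B _
    have h1 : geometricReal θ (g false ⁻¹' B ∩ Set.Iio (1 / 2)) =
        ENNReal.ofReal (1 - θ) * B.indicator 1 0 := by
      rw [geometricReal_apply, tsum_eq_single 0]
      · classical simp [g, Set.indicator_apply]
      · intro k hk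
        rw [Set.indicator_of_notMem, mul_zero]
        rintro ⟨-, h⟩
        have : (1 : ℝ) ≤ k := by exact_mod_cast Nat.one_le_iff_ne_zero.mpr hk
        simp only [Set.mem_Iio] at h
        linarith
    have h2 : ENNReal.ofReal (1 - p) * geometricReal θ B = ENNReal.ofReal (1 - p) *
        (ENNReal.ofReal (1 - θ) * B.indicator 1 0) +
          ENNReal.ofReal p * geometricReal θ (g true ⁻¹' B) := by
      rw [geometricReal_apply, geometricReal_apply, tsum_eq_zero_add' ENNReal.summable, mul_add,
        ← ENNReal.tsum_mul_left, ← ENNReal.tsum_mul_left]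
      congr 1
      · simp
      · refine tsum_congr fun k => ?_
        rw [hw]
        congr 2
        classical simp [g, Set.indicator_apply]
    rw [h1, h2, add_comm]

lemma expMeasure_one_Iic (t : ℝ) :
    expMeasure 1 (Set.Iic t) = ENNReal.ofReal (1 - Real.exp (-max t 0)) := by
  have := isProbabilityMeasure_expMeasure one_pos
  rw [← ofReal_cdf, cdf_expMeasure_eq one_pos]
  split_ifs with h
  · rw [max_eq_left h, one_mul]
  · rw [max_eq_right (le_of_not_ge h)]
    simp

instance nullSingletonClass_expMeasure (r : ℝ) : NullSingletonClass (expMeasure r) :=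
  nullSingletonClass_withDensity _

lemma expMeasure_one_Icc {x : ℝ} (hx : 0 ≤ x) (y : ℝ) :
    expMeasure 1 (Set.Icc x y) = ENNReal.ofReal (Real.exp (-x) - Real.exp (-y)) := by
  have := isProbabilityMeasure_expMeasure one_pos
  rw [measure_congr Ioc_ae_eq_Icc.symm]
  rcases le_total x y with h | h
  · rw [← Set.Iic_sdiff_Iic, measure_sdiff (Set.Iic_subset_Iic.mpr h)
      measurableSet_Iic.nullMeasurableSet (measure_ne_top _ _), expMeasure_one_Iic,
      expMeasure_one_Iic, max_eq_left hx, max_eq_left (hx.trans h), ← ENNReal.ofReal_sub]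
    · congr 1
      ring
    · simpa using hx
  · rw [Set.Ioc_eq_empty (not_lt.mpr h), measure_empty, ENNReal.ofReal_of_nonpos]
    simpa using h

lemma log_one_sub_mul_exp_sub_lt {q v w : ℝ} (hq : 0 < q) (hq2 : q ≤ 1 / 2) (hv : 0 ≤ v)
    (h : v < w) :
    Real.log (1 - q * Real.exp (-v)) < Real.log (1 - q * Real.exp (-w)) ∧
      Real.log (1 - q * Real.exp (-w)) - Real.log (1 - q * Real.exp (-v)) < w - v := by
  have hu' : Real.exp (-v) ≤ 1 := by simpa using hv
  have hu : Real.exp (-w) < Real.exp (-v) := by simpa using h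
  have hu0 : 0 < Real.exp (-w) := Real.exp_pos _
  have h1 : 0 < 1 - q * Real.exp (-v) := by nlinarith
  have h2 : 0 < 1 - q * Real.exp (-w) := by nlinarith
  constructor
  · exact Real.log_lt_log h1 (by nlinarith)
  · have : Real.log ((1 - q * Real.exp (-w)) * Real.exp (-w)) <
        Real.log ((1 - q * Real.exp (-v)) * Real.exp (-v)) := by
      refine Real.log_lt_log (by positivity) ?_
      have : 0 < (Real.exp (-v) - Real.exp (-w)) *
          (1 - q * (Real.exp (-v) + Real.exp (-w))) :=
        mul_pos (by linarith) (by nlinarith)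
      nlinarith
    rw [Real.log_mul h2.ne' hu0.ne', Real.log_mul h1.ne' (Real.exp_pos _).ne', Real.log_exp,
      Real.log_exp] at this
    linarith

theorem hasIntThickening_of_half_le {p p' : ℝ} (hp : 1 / 2 ≤ p) (hpp' : p < p') (hp' : p' < 1) :
    HasIntThickening p p' := by
  have hq0 : 0 < 1 - p := by linarith
  have hr0 : 0 < 1 - p' := by linarith
  have hp0 : 0 < p := by linarith
  have hp0' : 0 < p' := by linarith
  have := isProbabilityMeasure_expMeasure one_pos
  set ρ := expMeasure 1 with hρ
  set b := -Real.log ((1 - p') / (1 - p)) with hbdef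
  have hb : 0 < b := neg_pos.mpr (Real.log_neg (by positivity) (by rw [div_lt_one hq0]; linarith))
  have heb : Real.exp (-b) = (1 - p') / (1 - p) := by
    rw [hbdef, neg_neg, Real.exp_log (by positivity)]
  set a := Real.log (p' / p) with hadef
  have ha : 0 < a := Real.log_pos (by rwa [one_lt_div hp0])
  have hea : Real.exp a = p' / p := Real.exp_log (by positivity)
  let h : ℝ → ℝ := fun s => Real.log p' - Real.log (1 - (1 - p) * Real.exp (-max s 0))
  have hlt : ∀ {v w : ℝ}, 0 ≤ v → v < w → h w < h v ∧ h v - h w < w - v := by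
    intro v w hv hvw
    obtain ⟨h1, h2⟩ := log_one_sub_mul_exp_sub_lt hq0 (by linarith) hv hvw
    simp only [h, max_eq_left hv, max_eq_left (hv.trans hvw.le)]
    exact ⟨by linarith, by linarith⟩
  have hmax : ∀ s, h (max s 0) = h s := fun s => by simp [h]
  have hhb : h b = 0 := by
    simp only [h, max_eq_left hb.le, heb]
    rw [mul_div_cancel₀ _ hq0.ne', sub_sub_cancel, sub_self]
  have hpos : ∀ {s}, s < b → 0 < h s := by
    intro s hs
    have := (hlt (le_max_right s 0) (max_lt hs hb)).1
    rwa [hmax, hhb] at this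
  have hneg : ∀ {s}, b ≤ s → h s ≤ 0 := by
    intro s hs
    rcases hs.eq_or_lt with rfl | hs
    · exact hhb.le
    · rw [← hhb]
      exact (hlt hb.le hs).1.le
  have hstrict : ∀ s s', s ≠ s' → |h s - h s'| < |s - s'| := by
    have key : ∀ s s', s < s' → |h s - h s'| < s' - s := by
      intro s s' hs
      rw [← hmax s, ← hmax s']
      have h0 : max s' 0 - max s 0 ≤ s' - s := by
        rcases le_total s 0 with h1 | h1 <;> rcases le_total s' 0 with h2 | h2 <;>
          simp only [max_eq_left, max_eq_right, h1, h2] <;> linarith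
      rcases (max_le_max_right 0 hs.le).eq_or_lt with he | hl
      · rw [he, sub_self, abs_zero]
        linarith
      · obtain ⟨h1, h2⟩ := hlt (le_max_right s 0) hl
        rw [abs_of_pos (by linarith)]
        linarith
    intro s s' hne
    rcases hne.lt_or_gt with hs | hs
    · rw [abs_sub_comm s, abs_of_pos (sub_pos.mpr hs)]
      exact key s s' hs
    · rw [abs_sub_comm, abs_of_pos (sub_pos.mpr hs)]
      exact key s' s hs
  have hlip : ∀ s s', |h s - h s'| ≤ |s - s'| := by
    intro s s'
    rcases eq_or_ne s s' with rfl | hne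
    · simp
    · exact (hstrict s s' hne).le
  let g : Bool → ℝ → ℝ := fun c s => bif c then s + a else max (s - b) (h s)
  have hgge : ∀ s, b ≤ s → g false s = s - b := fun s hs =>
    max_eq_left ((hneg hs).trans (by linarith))
  have hglt : ∀ s, s < b → g false s = h s := fun s hs =>
    max_eq_right (le_trans (by linarith) (hpos hs).le)
  have hgtrue : ∀ s, g true s = s + a := fun _ => rfl
  have hg : ∀ c s s', |g c s - g c s'| ≤ |s - s'| := by
    rintro (_ | _) s s'
    · refine (abs_max_sub_max_le_max _ _ _ _).trans (max_le (le_of_eq ?_) (hlip s s'))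
      ring_nf
    · exact le_of_eq (by simp [g])
  have hgm : ∀ c, Measurable (g c) := fun c =>
    (LipschitzWith.of_dist_le_mul (K := 1) fun s s' => by
      simpa [Real.dist_eq] using hg c s s').continuous.measurable
  refine hasIntThickening_of_system (θ := b) (b := b) (ρ := ρ) (g := g) hp0.le (by linarith)
    hp0'.le hp'.le hg hb hgge ?_ (measure_singleton b) ?_ ?_
  · intro s s' hne hs
    rcases lt_or_ge s' b with hs' | hs'
    · rw [hglt s hs, hglt s' hs']
      exact hstrict s s' hne
    · rw [hglt s hs, hgge s' hs', abs_lt, abs_of_neg (by linarith)]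
      have h1 := hpos hs
      have h2 := hstrict s b hs.ne
      rw [hhb, sub_zero, abs_of_pos h1, abs_of_neg (by linarith)] at h2
      constructor <;> linarith
  · suffices ENNReal.ofReal (1 - p) • (ρ.restrict (Set.Ici b)).map (g false) =
        ENNReal.ofReal (1 - p') • ρ by
      intro B hB
      have := congrArg (fun m : Measure ℝ => m B) this
      simpa [Measure.map_apply (hgm false) hB, Measure.restrict_apply (hgm false hB)] using this
    have : IsFiniteMeasure (ENNReal.ofReal (1 - p) • (ρ.restrict (Set.Ici b)).map (g false)) :=
      Measure.smul_finite _ ENNReal.ofReal_ne_top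
    refine Measure.ext_of_Iic _ _ fun t => ?_
    rw [Measure.smul_apply, Measure.smul_apply, Measure.map_apply (hgm false) measurableSet_Iic,
      Measure.restrict_apply (hgm false measurableSet_Iic)]
    have hset : g false ⁻¹' Set.Iic t ∩ Set.Ici b = Set.Icc b (t + b) := by
      ext s
      simp only [Set.mem_inter_iff, Set.mem_preimage, Set.mem_Iic, Set.mem_Ici, Set.mem_Icc]
      constructor
      · rintro ⟨h1, h2⟩
        rw [hgge s h2] at h1
        exact ⟨h2, by linarith⟩
      · rintro ⟨h1, h2⟩
        rw [hgge s h1]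
        exact ⟨by linarith, h1⟩
    rw [hset, hρ, expMeasure_one_Icc hb.le, expMeasure_one_Iic, smul_eq_mul, smul_eq_mul,
      ← ENNReal.ofReal_mul hq0.le, ← ENNReal.ofReal_mul hr0.le, neg_add, Real.exp_add, heb]
    rcases le_total 0 t with ht | ht
    · rw [max_eq_left ht]
      congr 1
      field_simp
    · rw [max_eq_right ht, ENNReal.ofReal_of_nonpos, ENNReal.ofReal_of_nonpos]
      · simp
      · have : 1 ≤ Real.exp (-t) := by simpa using ht
        have h' : 0 < (1 - p') / (1 - p) := by positivity
        exact mul_nonpos_of_nonneg_of_nonpos hq0.le (by nlinarith)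
  · suffices ENNReal.ofReal p • ρ.map (g true) +
        ENNReal.ofReal (1 - p) • (ρ.restrict (Set.Iio b)).map (g false) =
          ENNReal.ofReal p' • ρ by
      intro B hB
      have := congrArg (fun m : Measure ℝ => m B) this
      simpa [Measure.map_apply (hgm _) hB, Measure.restrict_apply (hgm _ hB)] using this
    have : IsFiniteMeasure (ENNReal.ofReal (1 - p) • (ρ.restrict (Set.Iio b)).map (g false)) :=
      Measure.smul_finite _ ENNReal.ofReal_ne_top
    have : IsFiniteMeasure (ENNReal.ofReal p • ρ.map (g true)) :=
      Measure.smul_finite _ ENNReal.ofReal_ne_top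
    refine Measure.ext_of_Iic _ _ fun t => ?_
    rw [Measure.add_apply, Measure.smul_apply, Measure.smul_apply, Measure.smul_apply,
      Measure.map_apply (hgm _) measurableSet_Iic, Measure.map_apply (hgm _) measurableSet_Iic,
      Measure.restrict_apply (hgm false measurableSet_Iic)]
    have hset : g true ⁻¹' Set.Iic t = Set.Iic (t - a) := by
      ext s
      simp [hgtrue, le_sub_iff_add_le]
    have hle : ∀ s, s < b → (g false s ≤ t ↔
        (1 - p) * Real.exp (-max s 0) ≤ 1 - p' * Real.exp (-t)) := by
      intro s hs
      have he : Real.exp (-max s 0) ≤ 1 := by simp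
      rw [hglt s hs]
      simp only [h]
      rw [sub_le_comm, ← Real.log_exp t, ← Real.log_div hp0'.ne' (Real.exp_pos _).ne',
        Real.log_le_log_iff (by positivity) (by nlinarith), Real.log_exp, div_eq_mul_inv,
        ← Real.exp_neg, le_sub_comm]
    rw [hset, hρ, expMeasure_one_Iic, expMeasure_one_Iic]
    simp only [smul_eq_mul]
    rcases lt_or_ge t 0 with ht | ht
    · have hset' : g false ⁻¹' Set.Iic t ∩ Set.Iio b = ∅ := by
        refine Set.eq_empty_of_forall_notMem fun s ⟨h1, h2⟩ => ?_
        simp only [Set.mem_preimage, Set.mem_Iic] at h1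
        rw [hglt s h2] at h1
        linarith [hpos h2]
      rw [hset', measure_empty, max_eq_right ht.le, max_eq_right (by linarith)]
      simp
    have hett : Real.exp (-t) ≤ 1 := by simpa using ht
    rw [max_eq_left ht]
    rcases le_or_gt a t with hat | hat
    · have hset' : g false ⁻¹' Set.Iic t ∩ Set.Iio b = Set.Iio b := by
        refine Set.inter_eq_right.mpr fun s hs => ?_
        refine (hle s hs).mpr ?_
        have h1 : Real.exp (-max s 0) ≤ 1 := by simp
        have h2 : Real.exp (-t) ≤ p / p' := by
          rw [← inv_div, ← hea, ← Real.exp_neg]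
          simpa using hat
        have h3 : p' * Real.exp (-t) ≤ p := by
          rw [le_div_iff₀ hp0'] at h2
          linarith
        nlinarith
      have he : Real.exp (-(t - a)) = p' / p * Real.exp (-t) := by
        rw [neg_sub, sub_eq_add_neg, Real.exp_add, hea]
      rw [hset', measure_congr Iio_ae_eq_Iic, expMeasure_one_Iic, max_eq_left hb.le,
        max_eq_left (by linarith), heb, he]
      have h1 : 0 ≤ 1 - p' / p * Real.exp (-t) := by
        rw [← hea, ← Real.exp_add]
        simpa using hat
      have h2 : 0 ≤ 1 - (1 - p') / (1 - p) := by
        rw [sub_nonneg, div_le_one hq0]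
        linarith
      rw [← ENNReal.ofReal_mul hp0.le, ← ENNReal.ofReal_mul hq0.le, ← ENNReal.ofReal_mul hp0'.le,
        ← ENNReal.ofReal_add (mul_nonneg hp0.le h1) (mul_nonneg hq0.le h2)]
      congr 1
      field_simp
      ring
    · have h2 : p / p' < Real.exp (-t) := by
        rw [← inv_div, ← hea, ← Real.exp_neg]
        simpa using hat
      have h3 : p < p' * Real.exp (-t) := by
        rw [div_lt_iff₀ hp0'] at h2
        linarith
      have h4 : 0 < 1 - p' * Real.exp (-t) := by nlinarith
      set c := -Real.log ((1 - p' * Real.exp (-t)) / (1 - p)) with hc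
      have hec : Real.exp (-c) = (1 - p' * Real.exp (-t)) / (1 - p) := by
        rw [hc, neg_neg, Real.exp_log (by positivity)]
      have hc0 : 0 < c := by
        refine neg_pos.mpr (Real.log_neg (by positivity) ?_)
        rw [div_lt_one hq0]
        linarith
      have hset' : g false ⁻¹' Set.Iic t ∩ Set.Iio b = Set.Ico c b := by
        ext s
        simp only [Set.mem_inter_iff, Set.mem_preimage, Set.mem_Iic, Set.mem_Iio, Set.mem_Ico]
        refine and_congr_left fun hs => ?_
        rw [hle s hs, mul_comm, ← le_div_iff₀ hq0, ← hec, Real.exp_le_exp, neg_le_neg_iff,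
          le_max_iff]
        exact or_iff_left (not_le.mpr hc0)
      rw [hset', measure_congr Ico_ae_eq_Icc, expMeasure_one_Icc hc0.le, hec, heb,
        max_eq_right (by linarith)]
      rw [neg_zero, Real.exp_zero, sub_self, ENNReal.ofReal_zero, mul_zero, zero_add,
        ← ENNReal.ofReal_mul hq0.le, ← ENNReal.ofReal_mul hp0'.le]
      congr 1
      field_simp
      ring

lemma bernoulliMeasure_singleton (r : ℝ) (c : Bool) :
    _root_.bernoulliMeasure r {c} =
      if c then ENNReal.ofReal r else ENNReal.ofReal (1 - r) := by
  cases c <;> simp [_root_.bernoulliMeasure]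

lemma IsBernoulliProduct.eq_infinitePi {I : Type*} {r : ℝ} (h0 : 0 ≤ r) (h1 : r ≤ 1)
    {μ : Measure (I → Bool)} (h : IsBernoulliProduct r μ) :
    μ = Measure.infinitePi fun _ => _root_.bernoulliMeasure r := by
  classical
  have := isProbabilityMeasure_bernoulliMeasure h0 h1
  have := h.1
  have hlim := Measure.isProjectiveLimit_infinitePi fun _ : I => _root_.bernoulliMeasure r
  refine MeasureTheory.IsProjectiveLimit.unique (fun s => ?_) hlim
  refine Measure.ext_of_singleton fun b => ?_
  rw [Measure.map_apply (by fun_prop) (measurableSet_singleton b), Measure.pi_singleton]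
  have hs : s.restrict ⁻¹' ({b} : Set (s → Bool)) =
      {x : I → Bool | ∀ i ∈ s, x i = (fun i => if hi : i ∈ s then b ⟨i, hi⟩ else false) i} := by
    ext x
    simp only [Set.mem_preimage, Set.mem_singleton_iff, Set.mem_ofPred_eq, funext_iff,
      Subtype.forall, Finset.restrict]
    exact forall₂_congr fun i hi => by rw [dif_pos hi]
  rw [hs, h.2, ← Finset.prod_attach, Finset.univ_eq_attach]
  refine Finset.prod_congr rfl fun i _ => ?_
  rw [dif_pos i.2, bernoulliMeasure_singleton]

lemma isBernoulliProduct_infinitePi {r : ℝ} (h0 : 0 ≤ r) (h1 : r ≤ 1) (I : Type*) :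
    IsBernoulliProduct r (Measure.infinitePi fun _ : I => _root_.bernoulliMeasure r) := by
  have := isProbabilityMeasure_bernoulliMeasure h0 h1
  refine ⟨inferInstance, fun s b => ?_⟩
  have hs : {x : I → Bool | ∀ i ∈ s, x i = b i} = Set.pi s fun i => {b i} := by
    ext x
    simp
  rw [hs, Measure.infinitePi_pi _ fun i _ => measurableSet_singleton _]
  exact Finset.prod_congr rfl fun i _ => bernoulliMeasure_singleton r (b i)

lemma HasIntThickening.trans {p q r : ℝ} (h₁ : HasIntThickening p q)
    (h₂ : HasIntThickening q r) : HasIntThickening p r := by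
  obtain ⟨φ₁, hm₁, hle₁, hmap₁⟩ := h₁
  obtain ⟨φ₂, hm₂, hle₂, hmap₂⟩ := h₂
  have hc₁ : Measurable fun (x : ℤ → Bool) (i : ℤ) => φ₁ fun k => x (k + i) :=
    measurable_pi_lambda _ fun i => hm₁.comp (by fun_prop)
  have hc₂ : Measurable fun (x : ℤ → Bool) (i : ℤ) => φ₂ fun k => x (k + i) :=
    measurable_pi_lambda _ fun i => hm₂.comp (by fun_prop)
  refine ⟨fun x => φ₂ fun k => φ₁ fun j => x (j + k), hm₂.comp hc₁, fun x => ?_, ?_⟩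
  · refine le_trans ?_ (hle₂ _)
    simpa using hle₁ x
  · rw [← hmap₂, ← hmap₁, Measure.map_map hc₂ hc₁]
    congr 1
    funext x i
    simp only [Function.comp_apply]
    congr 1
    funext k
    congr 1
    funext j
    rw [add_assoc]

theorem hasIntThickening_of_max_lt {p p' : ℝ} (hp : 0 < p) (hp' : p' < 1)
    (hmax : max p (1 - p) < p') : HasIntThickening p p' := by
  obtain ⟨h1, h2⟩ := max_lt_iff.mp hmax
  rcases le_or_gt (1 / 2) p with h | h
  · exact hasIntThickening_of_half_le h h1 hp'
  · exact (hasIntThickening_one_sub hp h).trans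
      (hasIntThickening_of_half_le (by linarith) h2 hp')

/-- The identification of `ℤ^(n+1)` with `ℤ^n × ℤ` splitting off the first coordinate. -/
def finSuccEquivProd (n : ℕ) : (Fin (n + 1) → ℤ) ≃ (Fin n → ℤ) × ℤ where
  toFun i := (Fin.tail i, i 0)
  invFun q := Fin.cons q.2 q.1
  left_inv i := Fin.cons_self_tail i
  right_inv q := by simp

/-- A configuration on `ℤ^(n+1)` as a family of configurations on `ℤ` indexed by `ℤ^n`. -/
def rowsEquiv (n : ℕ) : ((Fin (n + 1) → ℤ) → Bool) ≃ᵐ ((Fin n → ℤ) → ℤ → Bool) :=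
  (MeasurableEquiv.piCongrLeft (fun _ => Bool) (finSuccEquivProd n)).trans
    (MeasurableEquiv.curry (Fin n → ℤ) ℤ Bool)

lemma rowsEquiv_apply (n : ℕ) (x : (Fin (n + 1) → ℤ) → Bool) (j : Fin n → ℤ) (k : ℤ) :
    rowsEquiv n x j k = x (Fin.cons k j) :=
  rfl

lemma infinitePi_map_rowsEquiv (n : ℕ) (β : Measure Bool) [IsProbabilityMeasure β] :
    (Measure.infinitePi fun _ : Fin (n + 1) → ℤ => β).map (rowsEquiv n) =
      Measure.infinitePi fun _ => Measure.infinitePi fun _ => β := by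
  have h₁ := Measure.infinitePi_map_piCongrLeft (fun _ => β) (finSuccEquivProd n)
  have h₂ := Measure.infinitePi_map_curry (ι := Fin n → ℤ) (κ := ℤ) (fun _ _ => β)
  rw [← h₂, ← h₁, Measure.map_map (by fun_prop) (by fun_prop)]
  rfl

/-- For `d ≥ 1` and `max(p, 1-p) < p'`, there is a discrete thickening from density `p`
to density `p'` on `{0,1}^{ℤ^d}` commuting with all shifts of `ℤ^d`. -/
theorem equivariant_discrete_thickening_exists (d : ℕ) (hd : 1 ≤ d) (p p' : ℝ)
    (hp : 0 < p) (hpp' : p < p') (hp' : p' < 1) (hmax : max p (1 - p) < p') :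
    ∃ f : ((Fin d → ℤ) → Bool) → ((Fin d → ℤ) → Bool), Measurable f ∧
      (∀ (v : Fin d → ℤ) (x : (Fin d → ℤ) → Bool),
        f (fun i => x (i + v)) = fun i => f x (i + v)) ∧
      ∀ μ : Measure ((Fin d → ℤ) → Bool), IsBernoulliProduct p μ →
        IsBernoulliProduct p' (μ.map f) ∧ ∀ᵐ x ∂μ, ∀ i : Fin d → ℤ, x i ≤ f x i := by
  obtain ⟨φ, hφ, hle, hmap⟩ := hasIntThickening_of_max_lt hp hp' hmax
  obtain ⟨n, rfl⟩ := Nat.exists_eq_add_of_le' hd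
  have hp1 : p ≤ 1 := (hpp'.trans hp').le
  have hp0' : 0 ≤ p' := (hp.trans hpp').le
  have := isProbabilityMeasure_bernoulliMeasure hp.le hp1
  have := isProbabilityMeasure_bernoulliMeasure hp0' hp'.le
  have hrow : Measurable fun (x : ℤ → Bool) (i : ℤ) => φ fun k => x (k + i) :=
    measurable_pi_lambda _ fun i => hφ.comp (by fun_prop)
  let f : ((Fin (n + 1) → ℤ) → Bool) → ((Fin (n + 1) → ℤ) → Bool) := fun x i =>
    φ fun k => x (Fin.cons (k + i 0) (Fin.tail i))
  have hf : Measurable f := measurable_pi_lambda _ fun i => hφ.comp (by fun_prop)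
  refine ⟨f, hf, fun v x => ?_, fun μ hμ => ⟨?_, .of_forall fun x i => ?_⟩⟩
  · funext i
    simp only [f]
    congr 1
    funext k
    congr 1
    funext m
    refine Fin.cases ?_ (fun m => ?_) m
    · simp [add_assoc]
    · simp [Fin.tail]
  · suffices μ.map f = Measure.infinitePi fun _ => _root_.bernoulliMeasure p' by
      rw [this]
      exact isBernoulliProduct_infinitePi hp0' hp'.le _
    apply (rowsEquiv n).map_measurableEquiv_injective
    have hcomp : rowsEquiv n ∘ f =
        (fun y j i => φ fun k => y j (k + i)) ∘ rowsEquiv n := by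
      funext x j i
      simp [rowsEquiv_apply, f]
    have hrows : Measurable fun (y : (Fin n → ℤ) → ℤ → Bool) j i => φ fun k => y j (k + i) :=
      measurable_pi_lambda _ fun j => hrow.comp (measurable_pi_apply j)
    rw [Measure.map_map (by fun_prop) hf, hcomp, ← Measure.map_map hrows (by fun_prop),
      hμ.eq_infinitePi hp.le hp1, infinitePi_map_rowsEquiv, infinitePi_map_rowsEquiv,
      ← hmap]
    exact Measure.infinitePi_map_pi _ fun _ => hrow
  · simpa [f] using hle fun k => x (Fin.cons (k + i 0) (Fin.tail i))
end

section
/- Let d ≥ 1 and 0 < p < p' < 1 with p' < max(p, 1−p), and let L be a subgroup of ℤ^d generated by d linearly independent vectors (a d-dimensional lattice of shifts). Then there is no discrete thickening from density p to density p' on {0,1}^{ℤ^d} which commutes with σ_v for every v ∈ L. -/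
open MeasureTheory ProbabilityTheory

/-- The mass that Bernoulli(`r`) gives to a Boolean, as a real number. -/
def bernoulliWeight (r : ℝ) (b : Bool) : ℝ := if b then r else 1 - r

lemma bernoulliWeight_pos {r : ℝ} (h0 : 0 < r) (h1 : r < 1) (b : Bool) :
    0 < bernoulliWeight r b := by
  cases b <;> simp [bernoulliWeight, h0, h1]

lemma sum_prod_bernoulliWeight {S : Type*} [Fintype S] [DecidableEq S] (r : ℝ) :
    ∑ x : S → Bool, ∏ s, bernoulliWeight r (x s) = 1 := by
  have h := Finset.prod_univ_sum (fun _ : S => (Finset.univ : Finset Bool))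
    (fun _ b => bernoulliWeight r b)
  rw [Fintype.piFinset_univ] at h
  rw [← h]
  simp [bernoulliWeight]

/-- A form of Gibbs' inequality: if `P ∘ φ` dominates the law of `Z` and `Q` is a subprobability
vector, then `E[log Q(Z)] ≤ E[log P(φ(Z))]`. -/
lemma integral_log_le_integral_log_comp {Ω A C : Type*} [MeasurableSpace Ω] (μ : Measure Ω)
    [IsProbabilityMeasure μ] [Fintype A] [MeasurableSpace A] [MeasurableSingletonClass A]
    {Z : Ω → A} (hZ : Measurable Z) (φ : A → C) {P : C → ℝ} (hP : ∀ c, 0 < P c)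
    (hPμ : ∀ a, μ.real (Z ⁻¹' {a}) ≤ P (φ a)) {Q : A → ℝ} (hQ : ∀ a, 0 < Q a)
    (hQ1 : ∑ a, Q a ≤ 1) :
    ∫ ω, Real.log (Q (Z ω)) ∂μ ≤ ∫ ω, Real.log (P (φ (Z ω))) ∂μ := by
  have : IsProbabilityMeasure (μ.map Z) := Measure.isProbabilityMeasure_map hZ.aemeasurable
  have key : ∀ g : A → ℝ, ∫ ω, g (Z ω) ∂μ = ∑ a, (μ.map Z).real {a} * g a := by
    intro g
    rw [← integral_map hZ.aemeasurable (measurable_of_finite g).aestronglyMeasurable,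
      integral_fintype .of_finite]
    simp
  have hsum : ∑ a, (μ.map Z).real {a} = 1 := by
    rw [sum_measureReal_singleton]
    simp
  rw [key fun a => Real.log (Q a), key fun a => Real.log (P (φ a)), ← sub_nonpos,
    ← Finset.sum_sub_distrib]
  calc ∑ a, ((μ.map Z).real {a} * Real.log (Q a) - (μ.map Z).real {a} * Real.log (P (φ a)))
      ≤ ∑ a, (Q a - (μ.map Z).real {a}) := by
        refine Finset.sum_le_sum fun a _ => ?_
        have h0 : 0 ≤ (μ.map Z).real {a} := measureReal_nonneg
        have h1 : (μ.map Z).real {a} ≤ P (φ a) := by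
          rw [map_measureReal_apply hZ (measurableSet_singleton a)]
          exact hPμ a
        rw [← mul_sub, ← Real.log_div (hQ a).ne' (hP _).ne']
        have h2 := Real.log_le_sub_one_of_pos (div_pos (hQ a) (hP (φ a)))
        have h3 : (μ.map Z).real {a} * (Q a / P (φ a)) ≤ Q a := by
          rw [mul_div_assoc', div_le_iff₀ (hP _), mul_comm]
          exact mul_le_mul_of_nonneg_left h1 (hQ a).le
        nlinarith [mul_le_mul_of_nonneg_left h2 h0]
    _ ≤ 0 := by
        rw [Finset.sum_sub_distrib, hsum]
        linarith

lemma integrable_log_bernoulliWeight {Ω : Type*} [MeasurableSpace Ω] (μ : Measure Ω)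
    [IsProbabilityMeasure μ] {b : Ω → Bool} (hb : Measurable b) (r : ℝ) :
    Integrable (fun ω => Real.log (bernoulliWeight r (b ω))) μ :=
  (Integrable.of_finite (μ := μ.map b)
    (f := fun b => Real.log (bernoulliWeight r b))).comp_measurable hb

lemma integral_log_bernoulliWeight {Ω : Type*} [MeasurableSpace Ω] (μ : Measure Ω)
    [IsProbabilityMeasure μ] {b : Ω → Bool} (hb : Measurable b) (r : ℝ) :
    ∫ ω, Real.log (bernoulliWeight r (b ω)) ∂μ =
      μ.real {ω | b ω = true} * Real.log r + (1 - μ.real {ω | b ω = true}) * Real.log (1 - r) := by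
  have hm : MeasurableSet {ω | b ω = true} := hb (measurableSet_singleton true)
  rw [← integral_map (f := fun c => Real.log (bernoulliWeight r c)) hb.aemeasurable
    (measurable_of_finite _).aestronglyMeasurable, integral_fintype .of_finite,
    ← probReal_compl_eq_one_sub hm, Fintype.sum_bool, map_measureReal_apply hb (by measurability),
    map_measureReal_apply hb (by measurability)]
  have h : {ω | b ω = true}ᶜ = b ⁻¹' {false} := by ext; simp
  have h' : {ω | b ω = true} = b ⁻¹' {true} := by ext; simp
  rw [h, h']
  simp [bernoulliWeight]

/-- If `Y` is an i.i.d. Bernoulli(`q`) family which is approximately (with error `ε` in every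
coordinate) a function of a family `X` of Bernoulli(`p`) variables, then the entropy of `Y` is
bounded by the sum of the entropies of the `X s` and a small error term. -/
lemma card_mul_binEntropy_le {Ω S T : Type*} [MeasurableSpace Ω] (μ : Measure Ω)
    [IsProbabilityMeasure μ] [Fintype S] [Fintype T] {p q ε : ℝ} (hp0 : 0 < p) (hp1 : p < 1)
    (hq0 : 0 < q) (hq1 : q < 1) (hε0 : 0 < ε) (hε1 : ε < 1)
    {X : S → Ω → Bool} (hX : ∀ s, Measurable (X s)) (hXp : ∀ s, μ.real {ω | X s ω = true} = p)
    {Y : T → Ω → Bool} (hY : ∀ t, Measurable (Y t)) (hYq : ∀ t, μ.real {ω | Y t ω = true} = q)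
    (hYjoint : ∀ y : T → Bool,
      μ.real {ω | ∀ t, Y t ω = y t} = ∏ t, bernoulliWeight q (y t))
    (G : (S → Bool) → T → Bool)
    (hG : ∀ t, μ.real {ω | Y t ω ≠ G (fun s => X s ω) t} ≤ ε) :
    Fintype.card T * Real.binEntropy q ≤ Fintype.card S * Real.binEntropy p +
      Fintype.card T * (Real.negMulLog ε - Real.log (1 - ε)) := by
  classical
  set E : T → Ω → Bool := fun t ω => xor (Y t ω) (G (fun s => X s ω) t) with hE
  have hXm : Measurable fun ω s => X s ω := measurable_pi_lambda _ hX
  have hEm : ∀ t, Measurable (E t) := fun t =>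
    (measurable_of_finite fun z : Bool × Bool => xor z.1 z.2).comp
      ((hY t).prodMk ((measurable_of_finite fun z => G z t).comp hXm))
  have hZ : Measurable fun ω => ((fun s => X s ω), fun t => E t ω) :=
    hXm.prodMk (measurable_pi_lambda _ hEm)
  let φ : (S → Bool) × (T → Bool) → T → Bool := fun z t => xor (z.2 t) (G z.1 t)
  have hφ : ∀ ω t, φ ((fun s => X s ω), fun t => E t ω) t = Y t ω := by
    intro ω t
    simp [φ, hE]
  have main := integral_log_le_integral_log_comp μ hZ φ
    (P := fun y => ∏ t, bernoulliWeight q (y t))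
    (Q := fun z => (∏ s, bernoulliWeight p (z.1 s)) * ∏ t, bernoulliWeight ε (z.2 t))
    (fun y => Finset.prod_pos fun t _ => bernoulliWeight_pos hq0 hq1 _)
    (fun a => by
      rw [← hYjoint]
      refine measureReal_mono ?_
      rintro ω rfl t
      exact (hφ ω t).symm)
    (fun z => mul_pos (Finset.prod_pos fun t _ => bernoulliWeight_pos hp0 hp1 _)
      (Finset.prod_pos fun t _ => bernoulliWeight_pos hε0 hε1 _))
    (by
      rw [Fintype.sum_prod_type]
      dsimp only
      rw [← Finset.sum_mul_sum, sum_prod_bernoulliWeight,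
        sum_prod_bernoulliWeight, one_mul])
  have hL : ∀ ω, Real.log ((∏ s, bernoulliWeight p (X s ω)) * ∏ t, bernoulliWeight ε (E t ω)) =
      (∑ s, Real.log (bernoulliWeight p (X s ω))) +
        ∑ t, Real.log (bernoulliWeight ε (E t ω)) := by
    intro ω
    rw [Real.log_mul (Finset.prod_pos fun t _ => bernoulliWeight_pos hp0 hp1 _).ne'
      (Finset.prod_pos fun t _ => bernoulliWeight_pos hε0 hε1 _).ne',
      Real.log_prod fun t _ => (bernoulliWeight_pos hp0 hp1 _).ne',
      Real.log_prod fun t _ => (bernoulliWeight_pos hε0 hε1 _).ne']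
  have hR : ∀ ω, Real.log (∏ t, bernoulliWeight q (Y t ω)) =
      ∑ t, Real.log (bernoulliWeight q (Y t ω)) := fun ω =>
    Real.log_prod fun t _ => (bernoulliWeight_pos hq0 hq1 _).ne'
  simp only [hφ, hL, hR] at main
  rw [integral_add (integrable_finsetSum _ fun s _ => integrable_log_bernoulliWeight μ (hX s) p)
      (integrable_finsetSum _ fun t _ => integrable_log_bernoulliWeight μ (hEm t) ε),
    integral_finsetSum _ fun s _ => integrable_log_bernoulliWeight μ (hX s) p,
    integral_finsetSum _ fun t _ => integrable_log_bernoulliWeight μ (hEm t) ε,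
    integral_finsetSum _ fun t _ => integrable_log_bernoulliWeight μ (hY t) q] at main
  simp only [integral_log_bernoulliWeight μ (hX _), integral_log_bernoulliWeight μ (hY _),
    hXp, hYq, Finset.sum_const, Finset.card_univ, nsmul_eq_mul] at main
  have hEbound : ∀ t, -(Real.negMulLog ε - Real.log (1 - ε)) ≤
      ∫ ω, Real.log (bernoulliWeight ε (E t ω)) ∂μ := by
    intro t
    rw [integral_log_bernoulliWeight μ (hEm t)]
    have h1 : μ.real {ω | E t ω = true} ≤ ε := by
      simpa [hE] using hG t
    have h0 : 0 ≤ μ.real {ω | E t ω = true} := measureReal_nonneg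
    have h2 : Real.log ε ≤ 0 := Real.log_nonpos hε0.le hε1.le
    have h3 : Real.log (1 - ε) ≤ 0 := Real.log_nonpos (by linarith) (by linarith)
    rw [Real.negMulLog]
    nlinarith [mul_nonneg h0 (neg_nonneg.2 h3), mul_le_mul_of_nonneg_right h1 (neg_nonneg.2 h2)]
  have hEsum := Finset.sum_le_sum fun t (_ : t ∈ (Finset.univ : Finset T)) => hEbound t
  rw [Finset.sum_const, Finset.card_univ, nsmul_eq_mul] at hEsum
  have hb : ∀ r : ℝ, Real.binEntropy r = -(r * Real.log r + (1 - r) * Real.log (1 - r)) := by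
    intro r
    rw [Real.binEntropy_eq_negMulLog_add_negMulLog_one_sub, Real.negMulLog, Real.negMulLog]
    ring
  rw [hb, hb]
  linarith

/-- A Boolean measurable function of infinitely many bits is approximated in measure by a function
of finitely many of them. -/
lemma exists_finset_approx {I : Type*} (μ : Measure (I → Bool)) [IsFiniteMeasure μ]
    {g : (I → Bool) → Bool} (hg : Measurable g) {ε : ℝ} (hε : 0 < ε) :
    ∃ (W : Finset I) (h : (W → Bool) → Bool),
      μ.real {x | g x ≠ h (W.restrict x)} ≤ ε := by
  classical
  obtain ⟨t, ht, hlt⟩ := exists_measure_symmDiff_lt_of_generateFrom_isSetRing (μ := μ)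
    (isSetRing_measurableCylinders (α := fun _ : I => Bool))
    ⟨{Set.univ}, Set.countable_singleton _, by
      simpa using univ_mem_measurableCylinders (fun _ : I => Bool), by simp⟩
    generateFrom_measurableCylinders.symm (hg (measurableSet_singleton true))
    (ENNReal.ofReal_pos.2 hε)
  obtain ⟨W, S, -, rfl⟩ := (mem_measurableCylinders _).1 ht
  refine ⟨W, fun z => decide (z ∈ S), ?_⟩
  refine ENNReal.toReal_le_of_le_ofReal hε.le (le_trans (measure_mono ?_) hlt.le)
  intro x hx
  simp only [Set.mem_ofPred_eq] at hx
  by_cases h1 : W.restrict x ∈ S <;> cases h2 : g x <;>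
    simp_all [Set.mem_symmDiff, mem_cylinder]

lemma IsBernoulliProduct.real_eq {I : Type*} {r : ℝ} (h0 : 0 ≤ r) (h1 : r ≤ 1)
    {μ : Measure (I → Bool)} (h : IsBernoulliProduct r μ) (s : Finset I) (b : I → Bool) :
    μ.real {x | ∀ i ∈ s, x i = b i} = ∏ i ∈ s, bernoulliWeight r (b i) := by
  rw [measureReal_def, h.2, ENNReal.toReal_prod]
  refine Finset.prod_congr rfl fun i _ => ?_
  cases b i <;> simp [bernoulliWeight, h0, h1]

lemma IsBernoulliProduct.eq {I : Type*} {r : ℝ} {μ ν : Measure (I → Bool)}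
    (hμ : IsBernoulliProduct r μ) (hν : IsBernoulliProduct r ν) : μ = ν := by
  classical
  have := hμ.1
  have := hν.1
  refine IsProjectiveLimit.unique (P := fun s : Finset I => ν.map s.restrict) (fun s => ?_)
    (fun s => rfl)
  refine Measure.ext_of_singleton fun z => ?_
  rw [Measure.map_apply (by fun_prop) (measurableSet_singleton z),
    Measure.map_apply (by fun_prop) (measurableSet_singleton z)]
  have hz : s.restrict (π := fun _ => Bool) ⁻¹' {z} =
      {x : I → Bool | ∀ i ∈ s, x i = (fun i => if h : i ∈ s then z ⟨i, h⟩ else false) i} := by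
    ext x
    simp only [Set.mem_preimage, Set.mem_singleton_iff, Set.mem_ofPred_eq, funext_iff,
      Subtype.forall, Finset.restrict]
    exact forall₂_congr fun i hi => by simp [hi]
  rw [hz, hμ.2, hν.2]

lemma IsBernoulliProduct.measurePreserving_shift {I : Type*} [AddGroup I] {r : ℝ}
    {μ : Measure (I → Bool)} (hμ : IsBernoulliProduct r μ) (u : I) :
    MeasurePreserving (fun (x : I → Bool) i => x (i + u)) μ μ := by
  have := hμ.1
  have hm : Measurable fun (x : I → Bool) i => x (i + u) := by fun_prop
  refine ⟨hm, IsBernoulliProduct.eq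
    ⟨Measure.isProbabilityMeasure_map hm.aemeasurable, fun s b => ?_⟩ hμ⟩
  have hs : MeasurableSet {x : I → Bool | ∀ i ∈ s, x i = b i} := by
    simp only [Set.ofPred_forall]
    exact .biInter s.countable_toSet fun i _ => measurable_pi_apply i (measurableSet_singleton _)
  rw [Measure.map_apply hm hs]
  have h := hμ.2 (s.map (addRightEmbedding u)) fun i => b (i - u)
  simpa using h

/-- Coordinates of a lattice-equivariant map are uniformly approximated by functions of finite
range. -/
lemma exists_finite_range_approx {d : ℕ} {r : ℝ} {μ : Measure ((Fin d → ℤ) → Bool)}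
    (hμ : IsBernoulliProduct r μ) (L : Submodule ℤ (Fin d → ℤ)) [Finite ((Fin d → ℤ) ⧸ L)]
    {f : ((Fin d → ℤ) → Bool) → ((Fin d → ℤ) → Bool)} (hf : Measurable f)
    (hfL : ∀ u ∈ L, ∀ x : (Fin d → ℤ) → Bool, f (fun i => x (i + u)) = fun i => f x (i + u))
    {ε : ℝ} (hε : 0 < ε) :
    ∃ R : ℕ, ∀ i : Fin d → ℤ, ∃ h : ((Fin d → ℤ) → Bool) → Bool,
      (∀ x y, (∀ j, (∀ k, |j k - i k| ≤ R) → x j = y j) → h x = h y) ∧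
        μ.real {x | f x i ≠ h x} ≤ ε := by
  have := hμ.1
  have := Fintype.ofFinite ((Fin d → ℤ) ⧸ L)
  have hfi : ∀ i, Measurable fun x => f x i := fun i => (measurable_pi_apply i).comp hf
  choose W h hW using fun c : (Fin d → ℤ) ⧸ L => exists_finset_approx μ (hfi c.out) hε
  let R : ℕ := Finset.univ.sup fun c => (W c).sup fun j => Finset.univ.sup fun k =>
    (j k - c.out k).natAbs
  have hR : ∀ c, ∀ j ∈ W c, ∀ k, |j k - c.out k| ≤ R := by
    intro c j hj k
    rw [Int.abs_eq_natAbs, Nat.cast_le]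
    calc (j k - c.out k).natAbs
        ≤ Finset.univ.sup fun k => (j k - c.out k).natAbs :=
          Finset.le_sup (f := fun k => (j k - c.out k).natAbs) (Finset.mem_univ k)
      _ ≤ (W c).sup fun j => Finset.univ.sup fun k => (j k - c.out k).natAbs :=
          Finset.le_sup (f := fun j => Finset.univ.sup fun k => (j k - c.out k).natAbs) hj
      _ ≤ R := Finset.le_sup (f := fun c => (W c).sup fun j => Finset.univ.sup fun k =>
          (j k - c.out k).natAbs) (Finset.mem_univ c)
  refine ⟨R, fun i => ?_⟩
  let c : (Fin d → ℤ) ⧸ L := Submodule.Quotient.mk i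
  let u : Fin d → ℤ := i - c.out
  have hu : u ∈ L := by
    rw [← Submodule.Quotient.eq L]
    exact (Quotient.out_eq' c).symm
  have hcu : c.out + u = i := by simp [u]
  refine ⟨fun x => h c ((W c).restrict fun j => x (j + u)), fun x y hxy => ?_, ?_⟩
  · dsimp only
    congr 1
    funext j
    refine hxy _ fun k => ?_
    have := hR c j j.2 k
    rw [← hcu]
    simpa using this
  · have hm := hμ.measurePreserving_shift u
    have hset : {x | f x i ≠ h c ((W c).restrict fun j => x (j + u))} =
        (fun (x : (Fin d → ℤ) → Bool) i => x (i + u)) ⁻¹'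
          {x | f x c.out ≠ h c ((W c).restrict x)} := by
      ext x
      simp only [Set.mem_ofPred_eq, Set.mem_preimage, hfL u hu x, hcu]
    rw [hset, hm.measureReal_preimage]
    · exact hW c
    · refine (measurableSet_eq_fun (hfi _)
        ((measurable_of_finite (h c)).comp ?_)).compl.nullMeasurableSet
      fun_prop

/-- Entropy does not increase under a lattice-equivariant factor map between Bernoulli fields. -/
lemma binEntropy_le_of_equivariant {d : ℕ} {p q : ℝ} (hp0 : 0 < p) (hp1 : p < 1) (hq0 : 0 < q)
    (hq1 : q < 1) {μ : Measure ((Fin d → ℤ) → Bool)} (hμ : IsBernoulliProduct p μ)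
    (L : Submodule ℤ (Fin d → ℤ)) [Finite ((Fin d → ℤ) ⧸ L)]
    {f : ((Fin d → ℤ) → Bool) → ((Fin d → ℤ) → Bool)} (hf : Measurable f)
    (hfL : ∀ u ∈ L, ∀ x : (Fin d → ℤ) → Bool, f (fun i => x (i + u)) = fun i => f x (i + u))
    (hfμ : IsBernoulliProduct q (μ.map f)) :
    Real.binEntropy q ≤ Real.binEntropy p := by
  classical
  have := hμ.1
  have hfin : ∀ ε : ℝ, 0 < ε → ε < 1 →
      Real.binEntropy q ≤ Real.binEntropy p + (Real.negMulLog ε - Real.log (1 - ε)) := by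
    intro ε hε0 hε1
    obtain ⟨R, hR⟩ := exists_finite_range_approx hμ L hf hfL hε0
    choose h hdep happ using hR
    let box : ℕ → Finset (Fin d → ℤ) := fun N => Finset.Icc (fun _ => -(N : ℤ)) fun _ => N
    have hcard : ∀ N, ((box N).card : ℝ) = (2 * N + 1) ^ d := by
      intro N
      have : (N + 1 + N : ℤ).toNat = 2 * N + 1 := by omega
      simp [box, Pi.card_Icc, this]
    have hbound : ∀ N : ℕ, (2 * N + 1 : ℝ) ^ d * Real.binEntropy q ≤
        (2 * (N + R : ℕ) + 1 : ℝ) ^ d * Real.binEntropy p +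
          (2 * N + 1 : ℝ) ^ d * (Real.negMulLog ε - Real.log (1 - ε)) := by
      intro N
      let extend : (box (N + R) → Bool) → (Fin d → ℤ) → Bool :=
        fun z j => if hj : j ∈ box (N + R) then z ⟨j, hj⟩ else false
      have key := card_mul_binEntropy_le μ hp0 hp1 hq0 hq1 hε0 hε1
        (X := fun (s : box (N + R)) x => x s) (Y := fun (t : box N) x => f x t)
        (fun s => measurable_pi_apply _)
        (fun s => by
          simpa [bernoulliWeight] using hμ.real_eq hp0.le hp1.le {s.1} fun _ => true)
        (fun t => (measurable_pi_apply _).comp hf)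
        (fun t => by
          have := hfμ.real_eq hq0.le hq1.le {t.1} fun _ => true
          rw [map_measureReal_apply hf] at this
          · simpa [bernoulliWeight] using this
          · simpa using measurableSet_eq_fun
              (measurable_pi_apply (X := fun _ => Bool) t.1) measurable_const)
        (fun y => by
          have := hfμ.real_eq hq0.le hq1.le (box N)
            fun i => if hi : i ∈ box N then y ⟨i, hi⟩ else false
          rw [map_measureReal_apply hf] at this
          · rw [← Finset.prod_coe_sort] at this
            simp only [Finset.coe_mem, dite_true, Subtype.coe_eta] at this
            rw [← this]
            congr 1
            ext x
            simp only [Set.mem_ofPred_eq, Set.mem_preimage, Subtype.forall]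
            exact forall₂_congr fun i hi => by simp [hi]
          · simp only [Set.ofPred_forall]
            exact .biInter (box N).countable_toSet fun i _ =>
              measurable_pi_apply i (measurableSet_singleton _))
        (fun z t => h t (extend z))
        (fun t => by
          have hx : ∀ x : (Fin d → ℤ) → Bool, h t (extend fun s => x s) = h t x := by
            intro x
            refine hdep t _ _ fun j hj => ?_
            have hmem : j ∈ box (N + R) := by
              have ht := t.2
              simp only [box, Finset.mem_Icc, Pi.le_def] at ht ⊢
              refine ⟨fun k => ?_, fun k => ?_⟩ <;>
              · have h1 := abs_le.1 (hj k)
                have h2 := ht.1 k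
                have h3 := ht.2 k
                push_cast
                omega
            simp [extend, hmem]
          simp only [hx]
          exact happ t)
      simpa only [Fintype.card_coe, hcard] using key
    have hlim : Filter.Tendsto (fun N : ℕ => ((2 * (N + R : ℕ) + 1 : ℝ) / (2 * N + 1)) ^ d)
        Filter.atTop (nhds 1) := by
      have h1 : Filter.Tendsto (fun N : ℕ => 1 + (2 * R : ℝ) / (2 * N + 1)) Filter.atTop
          (nhds (1 + 0)) := by
        refine tendsto_const_nhds.add (Filter.Tendsto.const_div_atTop ?_ _)
        exact Filter.tendsto_atTop_add_const_right _ _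
          (tendsto_natCast_atTop_atTop.const_mul_atTop two_pos)
      have h2 := h1.pow d
      rw [add_zero, one_pow] at h2
      refine h2.congr fun N => ?_
      congr 1
      have : (2 * N + 1 : ℝ) ≠ 0 := by positivity
      push_cast
      field_simp
      ring
    have hlim' := (hlim.mul_const (Real.binEntropy p)).add_const
      (Real.negMulLog ε - Real.log (1 - ε))
    rw [one_mul] at hlim'
    refine ge_of_tendsto' hlim' fun N => ?_
    have hpos : (0 : ℝ) < (2 * N + 1 : ℝ) ^ d := by positivity
    rw [div_pow, ← mul_le_mul_iff_right₀ hpos, mul_add, ← mul_assoc,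
      mul_div_cancel₀ _ hpos.ne']
    exact hbound N
  have hcont : Filter.Tendsto (fun ε : ℝ => Real.binEntropy p +
      (Real.negMulLog ε - Real.log (1 - ε))) (nhdsWithin 0 (Set.Ioi 0))
      (nhds (Real.binEntropy p)) := by
    have hc : ContinuousAt (fun ε : ℝ => Real.binEntropy p +
        (Real.negMulLog ε - Real.log (1 - ε))) 0 := by
      refine continuousAt_const.add (Real.continuous_negMulLog.continuousAt.sub ?_)
      exact ContinuousAt.log (by fun_prop) (by norm_num)
    have h := hc.tendsto.mono_left (nhdsWithin_le_nhds (s := Set.Ioi 0))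
    simpa using h
  refine ge_of_tendsto hcont ?_
  filter_upwards [Ioo_mem_nhdsGT (zero_lt_one' ℝ)] with ε hε
  exact hfin ε hε.1 hε.2

lemma binEntropy_lt_binEntropy {p q : ℝ} (hp : 0 ≤ p) (hpq : p < q) (hq : q < 1 - p) :
    Real.binEntropy p < Real.binEntropy q := by
  rcases le_total q 2⁻¹ with h | h
  · exact Real.binEntropy_strictMonoOn ⟨hp, by linarith⟩ ⟨by linarith, h⟩ hpq
  · rw [← Real.binEntropy_one_sub q]
    have h2 : (2 : ℝ)⁻¹ = 1 / 2 := by norm_num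
    rw [h2] at h
    exact Real.binEntropy_strictMonoOn ⟨hp, by linarith⟩ ⟨by linarith, by linarith⟩ (by linarith)

/-- For `d ≥ 1` and `p' < max(p, 1-p)`, there is no discrete thickening from density `p`
to density `p'` on `{0,1}^{ℤ^d}` commuting with a `d`-dimensional lattice of shifts. -/
theorem no_thickening_commuting_with_full_lattice (d : ℕ) (hd : 1 ≤ d) (p p' : ℝ)
    (hp : 0 < p) (hpp' : p < p') (hp' : p' < 1) (hmax : p' < max p (1 - p))
    (v : Fin d → (Fin d → ℤ)) (hv : LinearIndependent ℤ v)
    (μ : Measure ((Fin d → ℤ) → Bool)) (hμ : IsBernoulliProduct p μ) :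
    ¬ ∃ f : ((Fin d → ℤ) → Bool) → ((Fin d → ℤ) → Bool), Measurable f ∧
      (∀ u ∈ Submodule.span ℤ (Set.range v), ∀ x : (Fin d → ℤ) → Bool,
        f (fun i => x (i + u)) = fun i => f x (i + u)) ∧
      IsBernoulliProduct p' (μ.map f) ∧ (∀ᵐ x ∂μ, ∀ i : Fin d → ℤ, x i ≤ f x i) := by
  rintro ⟨f, hf, hfL, hfμ, -⟩
  have hpq : p' < 1 - p := (lt_max_iff.1 hmax).resolve_left hpp'.not_gt
  have : Finite ((Fin d → ℤ) ⧸ Submodule.span ℤ (Set.range v)) :=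
    Submodule.finiteQuotientOfFreeOfRankEq _ (by simp [finrank_span_eq_card hv])
  exact (binEntropy_lt_binEntropy hp.le hpp' hpq).not_ge
    (binEntropy_le_of_equivariant hp (hpp'.trans hp') (hp.trans hpp') hp' hμ _ hf hfL hfμ)
end
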